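/- arXiv:1510.04259 — 10 statements merged into one kernel-verified Lean document; each statement's English description precedes it below -/
import Mathlib

section
/- Let P ⊆ ℝ² be the convex hull of a finite set of points, assume P has nonempty interior and is symmetric about the origin (i.e. -P = P, π-rotational symmetry). Then there exist a linear map A : ℝ² → ℝ² with determinant 1 and a real number r > 0 such that B¹(r) ⊆ A(P) ⊆ B∞(r). -/
/-- A convex set stable under negation contains every absolutely convex combination of two of its
points. -/
theorem Convex.smul_add_smul_mem_of_neg_mem {E : Type*} [AddCommGroup E] [Module ℝ E] {s : Set E}
    (hs : Convex ℝ s) (hneg : ∀ x ∈ s, -x ∈ s) {u v : E} (hu : u ∈ s) (hv : v ∈ s) {a b : ℝ}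
    (hab : |a| + |b| ≤ 1) : a • u + b • v ∈ s := by
  have key : ∀ (w : E), w ∈ s → ∀ c : ℝ, ∃ w' ∈ s, c • w = |c| • w' := by
    intro w hw c
    rcases le_total 0 c with hc | hc
    · exact ⟨w, hw, by rw [abs_of_nonneg hc]⟩
    · exact ⟨-w, hneg w hw, by rw [abs_of_nonpos hc, neg_smul_neg]⟩
  obtain ⟨u', hu', hau⟩ := key u hu a
  obtain ⟨v', hv', hbv⟩ := key v hv b
  have h0 : (0 : E) ∈ s := by
    have h := hs hu (hneg u hu) (a := 1 / 2) (b := 1 / 2) (by norm_num) (by norm_num) (by norm_num)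
    simpa using h
  have h := hs.sum_mem (t := Finset.univ) (w := ![|a|, |b|, 1 - |a| - |b|]) (z := ![u', v', 0])
    (by
      intro i _
      fin_cases i
      · exact abs_nonneg a
      · exact abs_nonneg b
      · change 0 ≤ 1 - |a| - |b|
        linarith)
    (by simp [Fin.sum_univ_three])
    (by
      intro i _
      fin_cases i
      exacts [hu', hv', h0])
  rw [hau, hbv]
  simpa [Fin.sum_univ_three] using h

/-- A subset of the plane with nonempty interior contains two points spanning a
positively oriented parallelogram. -/
theorem exists_det_pos_of_interior_nonempty {P : Set (ℝ × ℝ)} (hint : (interior P).Nonempty) :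
    ∃ u ∈ P, ∃ v ∈ P, 0 < u.1 * v.2 - u.2 * v.1 := by
  obtain ⟨x, hx⟩ := hint
  obtain ⟨e, he, hball⟩ := Metric.nhds_basis_closedBall.mem_iff.1 (mem_interior_iff_mem_nhds.1 hx)
  have hx0 : x ∈ P := interior_subset hx
  have h1 : (x.1 + e, x.2) ∈ P := hball (by
    simp [Metric.mem_closedBall, Prod.dist_eq, abs_of_pos he, he.le])
  have h2 : (x.1, x.2 + e) ∈ P := hball (by
    simp [Metric.mem_closedBall, Prod.dist_eq, abs_of_pos he, he.le])
  by_contra! hle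
  have hzero : ∀ u ∈ P, ∀ v ∈ P, u.1 * v.2 - u.2 * v.1 = 0 := by
    intro u hu v hv
    have h := hle u hu v hv
    have h' := hle v hv u hu
    linarith
  have k1 := hzero _ hx0 _ h1
  have k2 := hzero _ hx0 _ h2
  have k3 := hzero _ h1 _ h2
  simp only at k1 k2 k3
  have : 0 < e * e := mul_pos he he
  linarith

/-- **Round Polygon Lemma.** Let `P ⊆ ℝ²` be the convex hull of a finite set of
points, assume `P` has nonempty interior and is symmetric about the origin
(`-P = P`). Then there are a linear map `A` of determinant `1` and `r > 0` with
`B¹(r) ⊆ A(P) ⊆ B∞(r)`. -/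
theorem round_polygon_lemma
    (F : Set (ℝ × ℝ)) (hF : F.Finite)
    (P : Set (ℝ × ℝ)) (hP : P = convexHull ℝ F)
    (hint : (interior P).Nonempty)
    (hsymm : -P = P) :
    ∃ A : (ℝ × ℝ) →ₗ[ℝ] (ℝ × ℝ), ∃ r : ℝ, 0 < r ∧
      LinearMap.det A = 1 ∧
      {p : ℝ × ℝ | |p.1| + |p.2| ≤ r} ⊆ A '' P ∧
      A '' P ⊆ {p : ℝ × ℝ | |p.1| ≤ r ∧ |p.2| ≤ r} := by
  have hneg : ∀ x ∈ P, -x ∈ P := fun x hx => by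
    rw [← hsymm]
    simpa using hx
  have hconv : Convex ℝ P := hP ▸ convex_convexHull ℝ F
  have hcomp : IsCompact P := hP ▸ hF.isCompact_convexHull (𝕜 := ℝ)
  obtain ⟨u₀, hu₀, v₀, hv₀, hpos⟩ := exists_det_pos_of_interior_nonempty hint
  obtain ⟨⟨u, v⟩, ⟨hu, hv⟩, hmax⟩ := (hcomp.prod hcomp).exists_isMaxOn ⟨(u₀, v₀), hu₀, hv₀⟩
    (f := fun q : (ℝ × ℝ) × (ℝ × ℝ) => q.1.1 * q.2.2 - q.1.2 * q.2.1) (by fun_prop)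
  have hle : ∀ p ∈ P, ∀ q ∈ P, p.1 * q.2 - p.2 * q.1 ≤ u.1 * v.2 - u.2 * v.1 :=
    fun p hp q hq => hmax (Set.mk_mem_prod hp hq)
  have hD := hpos.trans_le (hle u₀ hu₀ v₀ hv₀)
  obtain ⟨r, hr, hrD⟩ : ∃ r : ℝ, 0 < r ∧ r * r = u.1 * v.2 - u.2 * v.1 :=
    ⟨√(u.1 * v.2 - u.2 * v.1), Real.sqrt_pos.2 hD, Real.mul_self_sqrt hD.le⟩
  have hr0 : r ≠ 0 := hr.ne'
  refine ⟨Matrix.toLin (Module.Basis.finTwoProd ℝ) (Module.Basis.finTwoProd ℝ)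
    !![v.2 / r, -v.1 / r; -u.2 / r, u.1 / r], r, hr, ?_, ?_, ?_⟩
  · rw [LinearMap.det_toLin, Matrix.det_fin_two_of]
    field_simp
    linarith
  · rintro q (hq : |q.1| + |q.2| ≤ r)
    refine ⟨(q.1 / r) • u + (q.2 / r) • v,
      hconv.smul_add_smul_mem_of_neg_mem hneg hu hv ?_, ?_⟩
    · rw [abs_div, abs_div, abs_of_pos hr, ← add_div]
      exact (div_le_one hr).2 hq
    · rw [Matrix.toLin_finTwoProd_apply]
      ext
      · simp only [Prod.fst_add, Prod.snd_add, Prod.smul_fst, Prod.smul_snd, smul_eq_mul]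
        field_simp
        linear_combination -q.1 * hrD
      · simp only [Prod.fst_add, Prod.snd_add, Prod.smul_fst, Prod.smul_snd, smul_eq_mul]
        field_simp
        linear_combination -q.2 * hrD
  · rintro _ ⟨p, hp, rfl⟩
    have h1 := hle p hp v hv
    have h2 := hle _ (hneg p hp) v hv
    have h3 := hle u hu p hp
    have h4 := hle u hu _ (hneg p hp)
    simp only [Prod.fst_neg, Prod.snd_neg] at h2 h4
    rw [Matrix.toLin_finTwoProd_apply]
    constructor
    · have : v.2 / r * p.1 + -v.1 / r * p.2 = (p.1 * v.2 - p.2 * v.1) / r := by ring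
      rw [this, abs_div, abs_of_pos hr, div_le_iff₀ hr, abs_le]
      constructor <;> linarith
    · have : -u.2 / r * p.1 + u.1 / r * p.2 = (u.1 * p.2 - u.2 * p.1) / r := by ring
      rw [this, abs_div, abs_of_pos hr, div_le_iff₀ hr, abs_le]
      constructor <;> linarith
end

section
/- Let P ⊆ ℝ² be a nonempty compact convex set with -P = P. Then there exist points p, q ∈ P such that {a•p + b•q : a,b ∈ ℝ, |a| + |b| ≤ 1} ⊆ P and P ⊆ {a•p + b•q : a,b ∈ ℝ, |a| ≤ 1, |b| ≤ 1}. -/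
/-- A symmetric convex set contains every `a • p + b • q` with `|a| + |b| ≤ 1`, for `p`, `q` in
it. -/
lemma Convex.smul_add_smul_mem_of_neg_eq {E : Type*} [AddCommGroup E] [Module ℝ E] {s : Set E}
    (hs : Convex ℝ s) (hsymm : -s = s) {p q : E} (hp : p ∈ s) (hq : q ∈ s) {a b : ℝ}
    (hab : |a| + |b| ≤ 1) : a • p + b • q ∈ s := by
  have neg_mem : ∀ x ∈ s, -x ∈ s := fun x hx ↦ by
    rw [← hsymm]
    simpa using hx
  have exists_abs_smul : ∀ (c : ℝ), ∀ x ∈ s, ∃ y ∈ s, |c| • y = c • x := fun c x hx ↦ by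
    rcases abs_choice c with h | h
    · exact ⟨x, hx, by rw [h]⟩
    · exact ⟨-x, neg_mem x hx, by rw [h, neg_smul_neg]⟩
  have zero_mem : (0 : E) ∈ s := by
    have h := hs hp (neg_mem p hp) (by norm_num : (0 : ℝ) ≤ 1 / 2)
      (by norm_num : (0 : ℝ) ≤ 1 / 2) (by norm_num)
    simpa using h
  obtain ⟨p', hp', hap⟩ := exists_abs_smul a p hp
  obtain ⟨q', hq', hbq⟩ := exists_abs_smul b q hq
  have h := hs.sum_mem (t := Finset.univ) (w := ![|a|, |b|, 1 - |a| - |b|]) (z := ![p', q', 0])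
    (by simp [Fin.forall_fin_succ]; linarith) (by simp [Fin.sum_univ_three])
    (by simp [Fin.forall_fin_succ, hp', hq', zero_mem])
  simpa [Fin.sum_univ_three, hap, hbq] using h


/-- Maximal inscribed parallelogram: if `P ⊆ ℝ²` is a nonempty compact convex
set with `-P = P`, then there are `p, q ∈ P` with
`{a•p + b•q : |a| + |b| ≤ 1} ⊆ P ⊆ {a•p + b•q : |a| ≤ 1, |b| ≤ 1}`. -/
theorem inscribed_parallelogram
    (P : Set (ℝ × ℝ)) (hne : P.Nonempty) (hcpt : IsCompact P)
    (hconv : Convex ℝ P) (hsymm : -P = P) :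
    ∃ p ∈ P, ∃ q ∈ P,
      {x : ℝ × ℝ | ∃ a b : ℝ, |a| + |b| ≤ 1 ∧ x = a • p + b • q} ⊆ P ∧
      P ⊆ {x : ℝ × ℝ | ∃ a b : ℝ, |a| ≤ 1 ∧ |b| ≤ 1 ∧ x = a • p + b • q} := by
  have inner_subset : ∀ p ∈ P, ∀ q ∈ P,
      {x : ℝ × ℝ | ∃ a b : ℝ, |a| + |b| ≤ 1 ∧ x = a • p + b • q} ⊆ P := by
    rintro p hp q hq _ ⟨a, b, hab, rfl⟩
    exact hconv.smul_add_smul_mem_of_neg_eq hsymm hp hq hab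
  obtain ⟨⟨p, q⟩, ⟨hp, hq⟩, hmax⟩ := (hcpt.prod hcpt).exists_isMaxOn (hne.prod hne)
    (f := fun z : (ℝ × ℝ) × (ℝ × ℝ) ↦ |z.1.1 * z.2.2 - z.1.2 * z.2.1|) (by fun_prop)
  have det_le : ∀ u ∈ P, ∀ v ∈ P, |u.1 * v.2 - u.2 * v.1| ≤ |p.1 * q.2 - p.2 * q.1| :=
    fun u hu v hv ↦ hmax (Set.mk_mem_prod hu hv)
  by_cases hD : p.1 * q.2 - p.2 * q.1 = 0
  · obtain ⟨r, hr, hrmax⟩ := hcpt.exists_isMaxOn hne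
      (f := fun z : ℝ × ℝ ↦ z.1 ^ 2 + z.2 ^ 2) (by fun_prop)
    refine ⟨r, hr, r, hr, inner_subset r hr r hr, fun x hx ↦ ?_⟩
    have hle : x.1 ^ 2 + x.2 ^ 2 ≤ r.1 ^ 2 + r.2 ^ 2 := hrmax hx
    have hdet : x.1 * r.2 - x.2 * r.1 = 0 := by simpa [hD] using det_le x hx r hr
    rcases (add_nonneg (sq_nonneg r.1) (sq_nonneg r.2)).eq_or_lt with h0 | hpos
    · refine ⟨0, 0, by simp, by simp, ?_⟩
      have h1 : x.1 = 0 := by nlinarith [sq_nonneg x.1, sq_nonneg x.2]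
      have h2 : x.2 = 0 := by nlinarith [sq_nonneg x.1, sq_nonneg x.2]
      ext <;> simp [h1, h2]
    · refine ⟨(x.1 * r.1 + x.2 * r.2) / (r.1 ^ 2 + r.2 ^ 2), 0, ?_, by simp, ?_⟩
      · rw [abs_div, abs_of_pos hpos, div_le_one hpos, abs_le]
        constructor <;>
          nlinarith [sq_nonneg (x.1 - r.1), sq_nonneg (x.2 - r.2), sq_nonneg (x.1 + r.1),
            sq_nonneg (x.2 + r.2)]
      · ext
        · simp only [Prod.fst_add, Prod.smul_fst, smul_eq_mul, zero_mul, add_zero]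
          field_simp
          linear_combination r.2 * hdet
        · simp only [Prod.snd_add, Prod.smul_snd, smul_eq_mul, zero_mul, add_zero]
          field_simp
          linear_combination -r.1 * hdet
  · refine ⟨p, hp, q, hq, inner_subset p hp q hq, fun x hx ↦
      ⟨(x.1 * q.2 - x.2 * q.1) / (p.1 * q.2 - p.2 * q.1),
        (p.1 * x.2 - p.2 * x.1) / (p.1 * q.2 - p.2 * q.1), ?_, ?_, ?_⟩⟩
    · rw [abs_div, div_le_one (abs_pos.2 hD)]
      exact det_le x hx q hq
    · rw [abs_div, div_le_one (abs_pos.2 hD)]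
      exact det_le p hp x hx
    · ext
      · simp only [Prod.fst_add, Prod.smul_fst, smul_eq_mul]
        rw [div_mul_eq_mul_div, div_mul_eq_mul_div, ← add_div, eq_div_iff hD]
        ring
      · simp only [Prod.snd_add, Prod.smul_snd, smul_eq_mul]
        rw [div_mul_eq_mul_div, div_mul_eq_mul_div, ← add_div, eq_div_iff hD]
        ring
end

section
/- Let u₁, …, u_k ∈ ℝ² be vectors that span ℝ², and let Z = {∑ᵢ tᵢ•uᵢ : 0 ≤ tᵢ ≤ 1} be the associated zonogon. Then the one-dimensional Hausdorff measure of the topological frontier of Z equals 2·∑ᵢ ‖uᵢ‖, where ‖·‖ is the Euclidean norm. -/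
open MeasureTheory
open scoped Pointwise

section Parallelepiped

variable {ι : Type*} [Fintype ι]

theorem parallelepiped_real (c : ι → ℝ) :
    parallelepiped c = Set.Icc (∑ i, min (c i) 0) (∑ i, max (c i) 0) := by
  classical
  rw [parallelepiped_eq_sum_segment]
  induction (Finset.univ : Finset ι) using Finset.induction_on with
  | empty => simp [Set.singleton_zero]
  | insert i s hi ih =>
    rw [Finset.sum_insert hi, Finset.sum_insert hi, Finset.sum_insert hi, ih, segment_eq_uIcc,
      Set.uIcc, Set.Icc_add_Icc inf_le_sup]
    · simp only [inf_comm, sup_comm]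
    · exact Finset.sum_le_sum fun j _ => (min_le_right _ _).trans (le_max_right _ _)

theorem volume_parallelepiped_real (c : ι → ℝ) :
    volume (parallelepiped c) = ENNReal.ofReal (∑ i, |c i|) := by
  rw [parallelepiped_real, Real.volume_Icc, ← Finset.sum_sub_distrib]
  congr 1
  refine Finset.sum_congr rfl fun i _ => ?_
  rw [max_sub_min_eq_abs', sub_zero]

variable {E : Type*} [NormedAddCommGroup E] [NormedSpace ℝ E]

theorem hausdorffMeasure_parallelepiped_smul [MeasurableSpace E] [BorelSpace E]
    (c : ι → ℝ) (w : E) :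
    μH[1] (parallelepiped fun i => c i • w) = ENNReal.ofReal (∑ i, ‖c i • w‖) := by
  have h : (parallelepiped fun i => c i • w) = (fun r : ℝ => r • w) '' parallelepiped c :=
    (image_parallelepiped (LinearMap.toSpanSingleton ℝ E w) c).symm
  rw [h, hausdorffMeasure_smul_right_image, hausdorffMeasure_real, volume_parallelepiped_real]
  simp only [norm_smul, ← Finset.sum_mul, Real.norm_eq_abs]
  rw [mul_comm, ENNReal.ofReal_mul (norm_nonneg w), ofReal_norm, ENNReal.smul_def, smul_eq_mul,
    enorm_eq_nnnorm]

theorem isCompact_parallelepiped (u : ι → E) : IsCompact (parallelepiped u) :=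
  isCompact_Icc.image (by fun_prop)

theorem zero_mem_parallelepiped (u : ι → E) : (0 : E) ∈ parallelepiped u :=
  (mem_parallelepiped_iff u 0).2 ⟨0, by simp, by simp⟩

theorem mem_parallelepiped_self (u : ι → E) (i : ι) : u i ∈ parallelepiped u := by
  classical
  refine (mem_parallelepiped_iff u _).2 ⟨Pi.single i 1, ⟨?_, ?_⟩, ?_⟩
  · simp
  · intro j
    by_cases h : j = i
    · subst h; simp
    · simp [h]
  · simp [Pi.single_apply]

theorem interior_parallelepiped_nonempty [FiniteDimensional ℝ E] (u : ι → E)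
    (hu : Submodule.span ℝ (Set.range u) = ⊤) : (interior (parallelepiped u)).Nonempty := by
  rw [(convex_parallelepiped u).interior_nonempty_iff_affineSpan_eq_top,
    AffineSubspace.affineSpan_eq_top_iff_vectorSpan_eq_top_of_nonempty ℝ E E
      ⟨0, zero_mem_parallelepiped u⟩, eq_top_iff, ← hu, Submodule.span_le]
  rintro _ ⟨i, rfl⟩
  simpa using vsub_mem_vectorSpan ℝ (mem_parallelepiped_self u i) (zero_mem_parallelepiped u)

/-- The face of a parallelepiped on which a functional is maximal is a translate of the
parallelepiped of those generators that the functional kills. -/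
theorem toExposed_parallelepiped (f : StrongDual ℝ E) (u : ι → E) :
    f.toExposed (parallelepiped u) =
      (fun x => (∑ i with 0 < f (u i), u i) + x) ''
        parallelepiped (fun i => if f (u i) = 0 then u i else 0) := by
  have hval (t : ι → ℝ) : f (∑ i, t i • u i) = ∑ i, t i * f (u i) := by simp
  have hterm (t : ι → ℝ) (ht : t ∈ Set.Icc (0 : ι → ℝ) 1) (i : ι) :
      t i * f (u i) ≤ max (f (u i)) 0 := by
    have h0 : 0 ≤ t i := ht.1 i
    have h1 : t i ≤ 1 := ht.2 i
    rcases le_total (f (u i)) 0 with h | h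
    · rw [max_eq_right h]; nlinarith
    · rw [max_eq_left h]; nlinarith
  have hsum : f (∑ i with 0 < f (u i), u i) = ∑ i, max (f (u i)) 0 := by
    rw [map_sum, Finset.sum_filter]
    refine Finset.sum_congr rfl fun i _ => ?_
    split_ifs with h
    · exact (max_eq_left h.le).symm
    · exact (max_eq_right (not_lt.1 h)).symm
  ext x
  constructor
  · rintro ⟨hx, hmax⟩
    obtain ⟨t, ht, rfl⟩ := (mem_parallelepiped_iff u x).1 hx
    have hp : (∑ i with 0 < f (u i), u i) ∈ parallelepiped u := by
      refine (mem_parallelepiped_iff u _).2 ⟨fun i => if 0 < f (u i) then 1 else 0, ⟨?_, ?_⟩, ?_⟩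
      · intro i; dsimp; split_ifs <;> norm_num
      · intro i; dsimp; split_ifs <;> norm_num
      · simp [Finset.sum_filter]
    have hle := hmax _ hp
    rw [hsum, hval] at hle
    have heq := (Finset.sum_eq_sum_iff_of_le fun i _ => hterm t ht i).1
      (le_antisymm (Finset.sum_le_sum fun i _ => hterm t ht i) hle)
    refine ⟨_, (mem_parallelepiped_iff _ _).2 ⟨t, ht, rfl⟩, ?_⟩
    dsimp only
    rw [Finset.sum_filter, ← Finset.sum_add_distrib]
    refine Finset.sum_congr rfl fun i hi => ?_
    have hi := heq i hi
    rcases lt_trichotomy (f (u i)) 0 with h | h | h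
    · rw [max_eq_right h.le] at hi
      have : t i = 0 := (mul_eq_zero.1 hi).resolve_right h.ne
      simp [h.not_gt, h.ne, this]
    · simp [h]
    · rw [max_eq_left h.le] at hi
      have : t i = 1 := mul_right_cancel₀ h.ne' (hi.trans (one_mul _).symm)
      simp [h, h.ne', this]
  · rintro ⟨y, hy, rfl⟩
    obtain ⟨t, ht, rfl⟩ := (mem_parallelepiped_iff _ y).1 hy
    refine ⟨(mem_parallelepiped_iff u _).2
      ⟨fun i => if 0 < f (u i) then 1 else if f (u i) = 0 then t i else 0, ⟨?_, ?_⟩, ?_⟩, ?_⟩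
    · intro i
      dsimp
      split_ifs
      exacts [zero_le_one, ht.1 i, le_rfl]
    · intro i
      dsimp
      split_ifs
      exacts [le_rfl, ht.2 i, zero_le_one]
    · dsimp only
      rw [Finset.sum_filter, ← Finset.sum_add_distrib]
      refine Finset.sum_congr rfl fun i _ => ?_
      rcases lt_trichotomy (f (u i)) 0 with h | h | h
      · simp [h.not_gt, h.ne]
      · simp [h]
      · simp [h, h.ne']
    · intro z hz
      obtain ⟨s, hs, rfl⟩ := (mem_parallelepiped_iff u z).1 hz
      have hk : f (∑ i, t i • if f (u i) = 0 then u i else 0) = 0 := by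
        rw [map_sum]
        refine Finset.sum_eq_zero fun i _ => ?_
        split_ifs with h <;> simp [h]
      rw [map_add, hk, add_zero, hsum, hval]
      exact Finset.sum_le_sum fun i _ => hterm s hs i

theorem toExposed_parallelepiped_subset_range_of_ne_zero (f : StrongDual ℝ E) (u : ι → E)
    (hf : ∀ i, u i ≠ 0 → f (u i) ≠ 0) :
    f.toExposed (parallelepiped u) ⊆ Set.range fun s : Finset ι => ∑ i ∈ s, u i := by
  rw [toExposed_parallelepiped]
  rintro _ ⟨y, hy, rfl⟩
  obtain ⟨t, -, rfl⟩ := (mem_parallelepiped_iff _ y).1 hy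
  refine ⟨_, (add_eq_left.2 (Finset.sum_eq_zero fun i _ => ?_)).symm⟩
  split_ifs with h
  · rw [not_imp_not.1 (hf i) h, smul_zero]
  · exact smul_zero _

theorem toExposed_subset_frontier {f : StrongDual ℝ E} (hf : f ≠ 0) (A : Set E) :
    f.toExposed A ⊆ frontier A := by
  rintro x ⟨hx, hmax⟩
  refine ⟨subset_closure hx, fun hint => hf ?_⟩
  have hloc : IsLocalMax f x := Filter.eventually_of_mem (mem_interior_iff_mem_nhds.1 hint) hmax
  simpa using hloc.hasFDerivAt_eq_zero f.hasFDerivAt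

end Parallelepiped

section EuclideanPlane

/-- The rotation of the Euclidean plane by a right angle. -/
noncomputable def quarterTurn (w : EuclideanSpace ℝ (Fin 2)) : EuclideanSpace ℝ (Fin 2) :=
  !₂[-w 1, w 0]

theorem norm_quarterTurn (w : EuclideanSpace ℝ (Fin 2)) : ‖quarterTurn w‖ = ‖w‖ := by
  simp [EuclideanSpace.norm_eq, quarterTurn, Fin.sum_univ_two, add_comm]

theorem inner_quarterTurn_self (w : EuclideanSpace ℝ (Fin 2)) : inner ℝ (quarterTurn w) w = 0 := by
  simp [PiLp.inner_apply, quarterTurn, Fin.sum_univ_two]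
  ring

theorem norm_sq_smul_eq_of_inner_eq_zero {n x : EuclideanSpace ℝ (Fin 2)} (h : inner ℝ n x = 0) :
    (‖n‖ ^ 2) • x = (inner ℝ (quarterTurn n) x : ℝ) • quarterTurn n := by
  simp only [PiLp.inner_apply, Fin.sum_univ_two, RCLike.inner_apply, conj_trivial] at h
  rw [EuclideanSpace.real_norm_sq_eq]
  ext i
  fin_cases i
  · simp [PiLp.inner_apply, quarterTurn, Fin.sum_univ_two]
    linear_combination n 0 * h
  · simp [PiLp.inner_apply, quarterTurn, Fin.sum_univ_two]
    linear_combination n 1 * h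

/-- A unit vector orthogonal to `w`. -/
noncomputable def unitNormal (w : EuclideanSpace ℝ (Fin 2)) : EuclideanSpace ℝ (Fin 2) :=
  ‖w‖⁻¹ • quarterTurn w

theorem norm_unitNormal {w : EuclideanSpace ℝ (Fin 2)} (hw : w ≠ 0) : ‖unitNormal w‖ = 1 := by
  rw [unitNormal, norm_smul, norm_quarterTurn, norm_inv, norm_norm,
    inv_mul_cancel₀ (norm_ne_zero_iff.2 hw)]

theorem inner_unitNormal_self (w : EuclideanSpace ℝ (Fin 2)) : inner ℝ (unitNormal w) w = 0 := by
  rw [unitNormal, real_inner_smul_left, inner_quarterTurn_self, mul_zero]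

theorem norm_eq_one_and_inner_eq_zero_iff {w : EuclideanSpace ℝ (Fin 2)} (hw : w ≠ 0)
    (n : EuclideanSpace ℝ (Fin 2)) :
    ‖n‖ = 1 ∧ inner ℝ n w = 0 ↔ n = unitNormal w ∨ n = -unitNormal w := by
  constructor
  · rintro ⟨hn, h⟩
    have hw' : ‖w‖ ≠ 0 := norm_ne_zero_iff.2 hw
    obtain ⟨c, hc⟩ : ∃ c : ℝ, n = c • unitNormal w := by
      have := norm_sq_smul_eq_of_inner_eq_zero ((real_inner_comm _ _).trans h)
      refine ⟨‖w‖⁻¹ * inner ℝ (quarterTurn w) n, ?_⟩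
      refine (inv_smul_smul₀ (pow_ne_zero 2 hw') n).symm.trans ?_
      rw [this, unitNormal, smul_smul, smul_smul]
      congr 1
      field_simp
    have : |c| = 1 := by
      rwa [hc, norm_smul, norm_unitNormal hw, mul_one, Real.norm_eq_abs] at hn
    rcases eq_or_eq_neg_of_abs_eq this with rfl | rfl
    · exact .inl (by simpa using hc)
    · exact .inr (by simpa using hc)
  · rintro (rfl | rfl)
    · exact ⟨norm_unitNormal hw, inner_unitNormal_self w⟩
    · exact ⟨(norm_neg _).trans (norm_unitNormal hw), by
        rw [inner_neg_left, inner_unitNormal_self, neg_zero]⟩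

theorem unitNormal_ne_neg {w : EuclideanSpace ℝ (Fin 2)} (hw : w ≠ 0) :
    unitNormal w ≠ -unitNormal w := by
  have := IsAddTorsionFree.of_isTorsionFree ℝ (EuclideanSpace ℝ (Fin 2))
  rw [Ne, self_eq_neg]
  exact norm_ne_zero_iff.1 (by rw [norm_unitNormal hw]; exact one_ne_zero)

variable {ι : Type*} [Fintype ι]

theorem hausdorffMeasure_toExposed_parallelepiped {n : EuclideanSpace ℝ (Fin 2)} (hn : ‖n‖ = 1)
    (u : ι → EuclideanSpace ℝ (Fin 2)) :
    μH[1] ((innerSL ℝ n).toExposed (parallelepiped u)) =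
      ENNReal.ofReal (∑ i, if inner ℝ n (u i) = 0 then ‖u i‖ else 0) := by
  rw [toExposed_parallelepiped, (isometry_add_left _).hausdorffMeasure_image (.inl zero_le_one)]
  have h : (fun i => if innerSL ℝ n (u i) = 0 then u i else 0) = fun i =>
      (if inner ℝ n (u i) = 0 then (inner ℝ (quarterTurn n) (u i) : ℝ) else 0) •
        quarterTurn n := by
    funext i
    rw [innerSL_apply_apply]
    split_ifs with h
    · simpa [hn] using norm_sq_smul_eq_of_inner_eq_zero h
    · rw [zero_smul]
  rw [h, hausdorffMeasure_parallelepiped_smul]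
  congr 1
  refine Finset.sum_congr rfl fun i _ => ?_
  rw [← congrFun h i, innerSL_apply_apply, apply_ite norm, norm_zero]

theorem toExposed_inter_toExposed_subsingleton {u : ι → EuclideanSpace ℝ (Fin 2)}
    (hu : Submodule.span ℝ (Set.range u) = ⊤) {m n : EuclideanSpace ℝ (Fin 2)}
    (hm : ‖m‖ = 1) (hn : ‖n‖ = 1) (hmn : m ≠ n) :
    ((innerSL ℝ m).toExposed (parallelepiped u) ∩
      (innerSL ℝ n).toExposed (parallelepiped u)).Subsingleton := by
  rintro x ⟨⟨hx, hxm⟩, -, hxn⟩ y ⟨⟨hy, hym⟩, -, hyn⟩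
  by_contra hxy
  simp only [innerSL_apply_apply] at hxm hxn hym hyn
  have hz := sub_ne_zero.2 hxy
  have hm' := (norm_eq_one_and_inner_eq_zero_iff hz m).1
    ⟨hm, by rw [inner_sub_right, sub_eq_zero]; exact le_antisymm (hym x hx) (hxm y hy)⟩
  have hn' := (norm_eq_one_and_inner_eq_zero_iff hz n).1
    ⟨hn, by rw [inner_sub_right, sub_eq_zero]; exact le_antisymm (hyn x hx) (hxn y hy)⟩
  have hneg : n = -m := by
    rcases hm' with rfl | rfl <;> rcases hn' with rfl | rfl <;> simp_all
  subst hneg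
  simp only [inner_neg_left, neg_le_neg_iff] at hxn
  have hconst (z) (hz : z ∈ parallelepiped u) : inner ℝ m z = inner ℝ m x :=
    le_antisymm (hxm z hz) (hxn z hz)
  have hzero : innerSL ℝ m = 0 := by
    refine ContinuousLinearMap.coe_injective (LinearMap.ext_on_range hu fun i => ?_)
    have := (hconst _ (mem_parallelepiped_self u i)).trans
      (hconst _ (zero_mem_parallelepiped u)).symm
    simpa using this
  have := innerSL_apply_norm ℝ m
  rw [hzero, hm, norm_zero] at this
  exact zero_ne_one this

open Classical in
/-- The unit vectors orthogonal to some nonzero member of the family `u`. -/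
noncomputable def edgeNormals (u : ι → EuclideanSpace ℝ (Fin 2)) :
    Finset (EuclideanSpace ℝ (Fin 2)) :=
  Finset.univ.biUnion fun i => if u i = 0 then ∅ else {unitNormal (u i), -unitNormal (u i)}

theorem mem_edgeNormals {u : ι → EuclideanSpace ℝ (Fin 2)} {n : EuclideanSpace ℝ (Fin 2)} :
    n ∈ edgeNormals u ↔ ‖n‖ = 1 ∧ ∃ i, u i ≠ 0 ∧ inner ℝ n (u i) = 0 := by
  simp only [edgeNormals, Finset.mem_biUnion, Finset.mem_univ, true_and]
  rw [← exists_and_left]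
  refine exists_congr fun i => ?_
  by_cases h : u i = 0
  · simp [h]
  · simp [h, norm_eq_one_and_inner_eq_zero_iff h]

theorem sum_edgeNormals (u : ι → EuclideanSpace ℝ (Fin 2)) (i : ι) :
    (∑ n ∈ edgeNormals u, if inner ℝ n (u i) = 0 then ‖u i‖ else 0) = 2 * ‖u i‖ := by
  classical
  by_cases h : u i = 0
  · simp [h]
  have hfilter : {n ∈ edgeNormals u | inner ℝ n (u i) = 0} =
      {unitNormal (u i), -unitNormal (u i)} := by
    ext n
    rw [Finset.mem_filter, mem_edgeNormals, Finset.mem_insert, Finset.mem_singleton,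
      ← norm_eq_one_and_inner_eq_zero_iff h]
    exact ⟨fun hn => ⟨hn.1.1, hn.2⟩, fun hn => ⟨⟨hn.1, i, h, hn.2⟩, hn.2⟩⟩
  rw [← Finset.sum_filter, hfilter, Finset.sum_pair (unitNormal_ne_neg h), two_mul]

theorem frontier_parallelepiped_subset {u : ι → EuclideanSpace ℝ (Fin 2)}
    (hu : Submodule.span ℝ (Set.range u) = ⊤) :
    frontier (parallelepiped u) ⊆
      (⋃ n ∈ edgeNormals u, (innerSL ℝ n).toExposed (parallelepiped u)) ∪
        Set.range fun s : Finset ι => ∑ i ∈ s, u i := by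
  intro x hx
  have hxZ : x ∈ parallelepiped u := (isCompact_parallelepiped u).isClosed.frontier_subset hx
  obtain ⟨f, hf, hmax⟩ := geometric_hahn_banach_of_nonempty_interior_point
    (convex_parallelepiped u) hx.2 (interior_parallelepiped_nonempty u hu)
  by_cases hker : ∀ i, u i ≠ 0 → f (u i) ≠ 0
  · exact .inr (toExposed_parallelepiped_subset_range_of_ne_zero f u hker ⟨hxZ, hmax⟩)
  push Not at hker
  obtain ⟨i, hi, hfi⟩ := hker
  obtain ⟨v, rfl⟩ := (InnerProductSpace.toDual ℝ (EuclideanSpace ℝ (Fin 2))).surjective f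
  have hv : v ≠ 0 := fun h => hf (by rw [h, map_zero])
  simp only [InnerProductSpace.toDual_apply_apply] at hmax hfi
  refine .inl (Set.mem_biUnion (x := ‖v‖⁻¹ • v) ?_ ⟨hxZ, fun y hy => ?_⟩)
  · refine mem_edgeNormals.2 ⟨norm_smul_inv_norm hv, i, hi, ?_⟩
    rw [real_inner_smul_left, hfi, mul_zero]
  · simp only [innerSL_apply_apply, real_inner_smul_left]
    exact mul_le_mul_of_nonneg_left (hmax y hy) (by positivity)

theorem hausdorffMeasure_frontier_parallelepiped {u : ι → EuclideanSpace ℝ (Fin 2)}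
    (hu : Submodule.span ℝ (Set.range u) = ⊤) :
    μH[1] (frontier (parallelepiped u)) = ENNReal.ofReal (2 * ∑ i, ‖u i‖) := by
  have := Measure.nullSingletonClass_hausdorff (EuclideanSpace ℝ (Fin 2)) one_pos
  have hunion : μH[1] (frontier (parallelepiped u)) =
      μH[1] (⋃ n ∈ edgeNormals u, (innerSL ℝ n).toExposed (parallelepiped u)) := by
    refine le_antisymm ((measure_mono (frontier_parallelepiped_subset hu)).trans
      ((measure_union_le _ _).trans_eq ?_)) (measure_mono (Set.iUnion₂_subset fun n hn => ?_))
    · rw [(Set.finite_range _).measure_zero, add_zero]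
    · refine toExposed_subset_frontier (fun h => ?_) _
      have := innerSL_apply_norm ℝ n
      rw [h, (mem_edgeNormals.1 hn).1, norm_zero] at this
      exact zero_ne_one this
  rw [hunion, measure_biUnion_finset₀
    (fun m hm n hn hmn => (toExposed_inter_toExposed_subsingleton hu (mem_edgeNormals.1 hm).1
      (mem_edgeNormals.1 hn).1 hmn).measure_zero _)
    (fun n _ => (ContinuousLinearMap.toExposed.isExposed.isClosed
      (isCompact_parallelepiped u).isClosed).measurableSet.nullMeasurableSet),
    Finset.sum_congr rfl fun n hn =>
      hausdorffMeasure_toExposed_parallelepiped (mem_edgeNormals.1 hn).1 u,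
    ← ENNReal.ofReal_sum_of_nonneg, Finset.sum_comm, Finset.mul_sum]
  · simp only [sum_edgeNormals]
  · intro n _
    exact Finset.sum_nonneg fun i _ => by split_ifs <;> positivity

end EuclideanPlane

/-- The perimeter (one-dimensional Hausdorff measure of the frontier) of the
non-degenerate zonogon `Z = {∑ tᵢ • uᵢ : 0 ≤ tᵢ ≤ 1}` associated to spanning
vectors `u₁, …, u_k ∈ ℝ²` equals `2 ∑ ‖uᵢ‖`. -/
theorem zonogon_perimeter
    (k : ℕ) (u : Fin k → EuclideanSpace ℝ (Fin 2))
    (hspan : Submodule.span ℝ (Set.range u) = ⊤)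
    (Z : Set (EuclideanSpace ℝ (Fin 2)))
    (hZ : Z = {x | ∃ t : Fin k → ℝ,
      (∀ i, 0 ≤ t i ∧ t i ≤ 1) ∧ x = ∑ i, t i • u i}) :
    μH[1] (frontier Z) = ENNReal.ofReal (2 * ∑ i, ‖u i‖) := by
  subst hZ
  rw [← hausdorffMeasure_frontier_parallelepiped hspan]
  congr 2
  ext x
  rw [mem_parallelepiped_iff]
  simp only [Set.mem_ofPred_eq, Set.mem_Icc, Pi.le_def, Pi.zero_apply, Pi.one_apply, forall_and]
end

section
/- Let u₁, …, u_k ∈ ℝ², let Z = {∑ᵢ tᵢ•uᵢ : 0 ≤ tᵢ ≤ 1} be the associated zonogon, let area(Z) denote its two-dimensional Lebesgue measure, and let L = inf{∑ᵢ ‖A uᵢ‖ : A a linear map ℝ² → ℝ² with determinant 1}, where ‖·‖ is the Euclidean norm. Then π·area(Z) ≤ L² and L² ≤ 8·area(Z). -/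
open MeasureTheory

lemma integral_exp_mul_sin (n : ℤ) :
    ∫ x in (0 : ℝ)..Real.pi, Complex.exp (-(2 * n * Complex.I) * x) * Complex.sin x =
      2 / (1 - 4 * (n : ℂ) ^ 2) := by
  have hn : (1 - 4 * (n : ℂ) ^ 2) ≠ 0 := by
    have h : (1 - 4 * n ^ 2 : ℤ) ≠ 0 := by omega
    exact_mod_cast h
  have hI : Complex.I ^ 2 = -1 := Complex.I_sq
  have key : ∀ x : ℝ, HasDerivAt (fun x : ℝ => Complex.exp (-(2 * n * Complex.I) * x) *
      (-(2 * n * Complex.I) * Complex.sin x - Complex.cos x) / (1 - 4 * (n : ℂ) ^ 2))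
      (Complex.exp (-(2 * n * Complex.I) * x) * Complex.sin x) x := by
    intro x
    have h1 : HasDerivAt (fun z : ℂ => Complex.exp (-(2 * n * Complex.I) * z) *
      (-(2 * n * Complex.I) * Complex.sin z - Complex.cos z) / (1 - 4 * (n : ℂ) ^ 2))
      (Complex.exp (-(2 * n * Complex.I) * x) * Complex.sin x) (x : ℂ) := by
      have he := ((hasDerivAt_id (x : ℂ)).const_mul (-(2 * n * Complex.I))).cexp
      have hs := ((Complex.hasDerivAt_sin (x : ℂ)).const_mul (-(2 * n * Complex.I))).sub
        (Complex.hasDerivAt_cos (x : ℂ))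
      refine ((he.mul hs).div_const (1 - 4 * (n : ℂ) ^ 2)).congr_deriv ?_
      rw [div_eq_iff hn]
      simp only [id_eq, mul_one, Pi.sub_apply]
      linear_combination (4 * (n : ℂ) ^ 2 * Complex.exp (-(2 * n * Complex.I) * x) *
        Complex.sin x) * hI
    exact h1.comp_ofReal
  rw [intervalIntegral.integral_eq_sub_of_hasDerivAt (fun x _ => key x)
    (Continuous.intervalIntegrable (by fun_prop) _ _)]
  have hexp : Complex.exp (-(2 * n * Complex.I) * Real.pi) = 1 := by
    rw [Complex.exp_eq_one_iff]
    exact ⟨-n, by push_cast; ring⟩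
  rw [hexp]
  simp
  field_simp
  ring

/-- The Fourier series of `|sin|`. -/
lemma hasSum_abs_sin (x : ℝ) :
    HasSum (fun n : ℤ => 2 / Real.pi / (1 - 4 * (n : ℝ) ^ 2) * Real.cos (2 * n * x))
      |Real.sin x| := by
  have : Fact (0 < Real.pi) := ⟨Real.pi_pos⟩
  have hper : Function.Periodic (fun x : ℝ => ((|Real.sin x| : ℝ) : ℂ)) Real.pi := by
    intro x
    simp [Real.sin_add_pi]
  let f : C(AddCircle Real.pi, ℂ) :=
    ⟨hper.lift, continuous_coinduced_dom.mpr (by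
      change Continuous (fun x : ℝ => ((|Real.sin x| : ℝ) : ℂ))
      fun_prop)⟩
  have hf : ∀ x : ℝ, f (x : AddCircle Real.pi) = ((|Real.sin x| : ℝ) : ℂ) := fun x => rfl
  have hfour : ∀ (n : ℤ) (x : ℝ), fourier n (x : AddCircle Real.pi) =
      Complex.exp (2 * n * Complex.I * x) := by
    intro n x
    rw [fourier_coe_apply]
    congr 1
    have : (Real.pi : ℂ) ≠ 0 := by exact_mod_cast Real.pi_ne_zero
    field_simp
  have hc : ∀ n : ℤ, fourierCoeff f n = ((2 / Real.pi / (1 - 4 * (n : ℝ) ^ 2) : ℝ) : ℂ) := by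
    intro n
    rw [fourierCoeff_eq_intervalIntegral f n 0, zero_add]
    have : ∫ x in (0 : ℝ)..Real.pi, fourier (-n) (x : AddCircle Real.pi) • f x =
        ∫ x in (0 : ℝ)..Real.pi, Complex.exp (-(2 * n * Complex.I) * x) * Complex.sin x := by
      refine intervalIntegral.integral_congr fun x hx => ?_
      rw [Set.uIcc_of_le Real.pi_pos.le] at hx
      simp only [hfour, hf, smul_eq_mul]
      rw [abs_of_nonneg (Real.sin_nonneg_of_mem_Icc hx)]
      push_cast
      congr 2
      ring
    rw [this, integral_exp_mul_sin, Complex.real_smul]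
    push_cast
    ring
  have hsum : Summable (fourierCoeff f) := by
    have h0 : Summable fun n : ℤ => 2 / Real.pi * (1 / (n : ℝ) ^ 2) :=
      (Real.summable_one_div_int_pow.mpr one_lt_two).mul_left _
    refine Summable.of_norm_bounded_eventually h0 ?_
    rw [Filter.eventually_cofinite]
    refine (Set.finite_singleton (0 : ℤ)).subset fun n hn => ?_
    by_contra hne
    refine hn ?_
    have hn1 : (1 : ℝ) ≤ (n : ℝ) ^ 2 := by
      have : 0 < n ^ 2 := sq_pos_of_ne_zero hne
      exact_mod_cast this
    rw [hc, Complex.norm_real, Real.norm_eq_abs, abs_div, abs_of_pos (div_pos two_pos Real.pi_pos),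
      abs_of_neg (by linarith), div_eq_mul_one_div]
    gcongr
    linarith
  have h := has_pointwise_sum_fourier_series_of_summable hsum (x : AddCircle Real.pi)
  have h2 := Complex.hasSum_re h
  rw [hf, Complex.ofReal_re] at h2
  convert h2 using 2 with n
  rw [hc, hfour, smul_eq_mul, Complex.re_ofReal_mul, Complex.exp_re]
  simp

lemma sum_mul_abs_sin_le {ι : Type*} (s : Finset ι) (r θ : ι → ℝ) :
    ∑ i ∈ s, ∑ j ∈ s, r i * r j * |Real.sin (θ i - θ j)| ≤
      2 / Real.pi * (∑ i ∈ s, r i) ^ 2 := by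
  have h : HasSum (fun n : ℤ => ∑ i ∈ s, ∑ j ∈ s, r i * r j *
      (2 / Real.pi / (1 - 4 * (n : ℝ) ^ 2) * Real.cos (2 * n * (θ i - θ j))))
      (∑ i ∈ s, ∑ j ∈ s, r i * r j * |Real.sin (θ i - θ j)|) :=
    hasSum_sum fun i _ => hasSum_sum fun j _ => (hasSum_abs_sin _).mul_left _
  refine hasSum_le (fun n => ?_) h (hasSum_ite_eq 0 (2 / Real.pi * (∑ i ∈ s, r i) ^ 2))
  have hform : ∑ i ∈ s, ∑ j ∈ s, r i * r j *
      (2 / Real.pi / (1 - 4 * (n : ℝ) ^ 2) * Real.cos (2 * n * (θ i - θ j))) =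
      2 / Real.pi / (1 - 4 * (n : ℝ) ^ 2) * ((∑ i ∈ s, r i * Real.cos (2 * n * θ i)) ^ 2 +
        (∑ i ∈ s, r i * Real.sin (2 * n * θ i)) ^ 2) := by
    rw [sq (∑ i ∈ s, r i * Real.cos _), sq (∑ i ∈ s, r i * Real.sin _), Finset.sum_mul_sum, Finset.sum_mul_sum]
    simp only [← Finset.sum_add_distrib, Finset.mul_sum]
    refine Finset.sum_congr rfl fun i _ => Finset.sum_congr rfl fun j _ => ?_
    rw [mul_sub, Real.cos_sub]
    ring
  rw [hform]
  split_ifs with hn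
  · simp [hn]
  · have hn1 : (1 : ℝ) ≤ (n : ℝ) ^ 2 := by
      have : 0 < n ^ 2 := by positivity
      exact_mod_cast this
    exact mul_nonpos_of_nonpos_of_nonneg
      (div_nonpos_of_nonneg_of_nonpos (by positivity) (by linarith)) (by positivity)

/-- The determinant of two vectors of the Euclidean plane. -/
def planeDet (x y : EuclideanSpace ℝ (Fin 2)) : ℝ := x 0 * y 1 - x 1 * y 0

lemma sum_abs_planeDet_le {ι : Type*} (s : Finset ι) (v : ι → EuclideanSpace ℝ (Fin 2)) :
    ∑ i ∈ s, ∑ j ∈ s, |planeDet (v i) (v j)| ≤ 2 / Real.pi * (∑ i ∈ s, ‖v i‖) ^ 2 := by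
  have hpolar (i : ι) : ∃ θ : ℝ, v i 0 = ‖v i‖ * Real.cos θ ∧ v i 1 = ‖v i‖ * Real.sin θ := by
    have hnorm : ‖v i‖ = ‖(⟨v i 0, v i 1⟩ : ℂ)‖ := by
      simp [EuclideanSpace.norm_eq, Complex.norm_def, Complex.normSq_apply, sq]
    refine ⟨Complex.arg ⟨v i 0, v i 1⟩, ?_, ?_⟩
    · rw [hnorm, Complex.norm_mul_cos_arg]
    · rw [hnorm, Complex.norm_mul_sin_arg]
  choose θ hcos hsin using hpolar
  refine le_of_eq_of_le ?_ (sum_mul_abs_sin_le s (fun i => ‖v i‖) θ)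
  refine Finset.sum_congr rfl fun i _ => Finset.sum_congr rfl fun j _ => ?_
  have : planeDet (v i) (v j) = -(‖v i‖ * ‖v j‖ * Real.sin (θ i - θ j)) := by
    rw [planeDet, hcos i, hsin i, hcos j, hsin j, Real.sin_sub]
    ring
  rw [this, abs_neg, abs_mul, abs_of_nonneg (by positivity)]

/-- The linear map of the Euclidean plane with matrix `!![a, b; c, d]`. -/
noncomputable def planeMap (a b c d : ℝ) :
    EuclideanSpace ℝ (Fin 2) →ₗ[ℝ] EuclideanSpace ℝ (Fin 2) :=
  Matrix.toLpLin 2 2 !![a, b; c, d]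

lemma det_planeMap (a b c d : ℝ) : LinearMap.det (planeMap a b c d) = a * d - b * c := by
  simp [planeMap, Matrix.det_fin_two]

lemma planeMap_apply_zero (a b c d : ℝ) (x : EuclideanSpace ℝ (Fin 2)) :
    planeMap a b c d x 0 = a * x 0 + b * x 1 := by
  simp [planeMap, Matrix.toLpLin_apply, dotProduct, Fin.sum_univ_two]

lemma planeMap_apply_one (a b c d : ℝ) (x : EuclideanSpace ℝ (Fin 2)) :
    planeMap a b c d x 1 = c * x 0 + d * x 1 := by
  simp [planeMap, Matrix.toLpLin_apply, dotProduct, Fin.sum_univ_two]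

open Pointwise in
lemma Real.volume_add_Icc_le {S : Set ℝ} (hS : IsCompact S) (hconv : Convex ℝ S) :
    volume (S + Set.Icc 0 1) ≤ volume S + 1 := by
  rcases S.eq_empty_or_nonempty with rfl | hne
  · simp
  · rw [eq_Icc_of_connected_compact ⟨hne, hconv.isPreconnected⟩ hS]
    refine (measure_mono (Set.Icc_add_Icc_subset _ _ _ _)).trans ?_
    have : sInf S ≤ sSup S := Real.sInf_le_sSup S hS.bddBelow hS.bddAbove
    rw [Real.volume_Icc, Real.volume_Icc, ← ENNReal.ofReal_one,
      ← ENNReal.ofReal_add (by linarith) zero_le_one]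
    exact ENNReal.ofReal_le_ofReal (by linarith)

open Pointwise in
lemma volume_add_horizontal_segment_le {K : Set (ℝ × ℝ)} (hK : IsCompact K) (hconv : Convex ℝ K)
    {m c : ℝ} (hm : ∀ p ∈ K, p.2 ∈ Set.Icc m (m + c)) :
    volume (K + segment ℝ 0 ((1, 0) : ℝ × ℝ)) ≤ volume K + ENNReal.ofReal c := by
  have hseg : IsCompact (segment ℝ 0 ((1, 0) : ℝ × ℝ)) := by
    rw [segment_eq_image]
    exact isCompact_Icc.image (by fun_prop)
  have hslice (y : ℝ) : volume ((fun x => (x, y)) ⁻¹' (K + segment ℝ 0 ((1, 0) : ℝ × ℝ))) ≤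
      volume ((fun x => (x, y)) ⁻¹' K) + (Set.Icc m (m + c)).indicator 1 y := by
    have hsub : (fun x => (x, y)) ⁻¹' (K + segment ℝ 0 ((1, 0) : ℝ × ℝ)) ⊆
        (fun x => (x, y)) ⁻¹' K + Set.Icc 0 1 := by
      rintro x ⟨p, hp, q, hq, hpq⟩
      rw [segment_eq_image] at hq
      obtain ⟨t, ht, rfl⟩ := hq
      simp only [smul_zero, zero_add, Prod.smul_mk, smul_eq_mul, mul_one, mul_zero,
        Prod.ext_iff, Prod.fst_add, Prod.snd_add, add_zero] at hpq
      refine ⟨p.1, ?_, t, ht, hpq.1⟩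
      rw [Set.mem_preimage, ← hpq.2]
      exact hp
    refine (measure_mono hsub).trans ?_
    have hcl : Topology.IsClosedEmbedding (fun x : ℝ => (x, y)) :=
      Topology.IsClosedEmbedding.of_continuous_injective_isClosedMap (by fun_prop)
        (fun a b h => congrArg Prod.fst h) (isClosedMap_prodMk_right y)
    have hcS : IsCompact ((fun x => (x, y)) ⁻¹' K) := hcl.isCompact_preimage hK
    by_cases hy : y ∈ Set.Icc m (m + c)
    · rw [Set.indicator_of_mem hy]
      refine Real.volume_add_Icc_le hcS ?_
      intro a ha b hb s t hs ht hst
      have := hconv ha hb hs ht hst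
      simpa [← add_mul, hst] using this
    · have : (fun x => (x, y)) ⁻¹' K = ∅ :=
        Set.eq_empty_of_forall_notMem fun x hx => hy (hm _ hx)
      simp [this]
  rw [Measure.volume_eq_prod, Measure.prod_apply_symm (hK.add hseg).measurableSet,
    Measure.prod_apply_symm hK.measurableSet]
  refine (lintegral_mono hslice).trans ?_
  rw [lintegral_add_right _ (measurable_one.indicator measurableSet_Icc),
    lintegral_indicator_one measurableSet_Icc, Real.volume_Icc]
  simp

/-- The coordinates of the Euclidean plane, with values in the product `ℝ × ℝ`. -/
noncomputable def planeCoord : EuclideanSpace ℝ (Fin 2) ≃L[ℝ] ℝ × ℝ :=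
  (EuclideanSpace.equiv (Fin 2) ℝ).trans (ContinuousLinearEquiv.finTwoArrow ℝ ℝ)

lemma planeCoord_apply (x : EuclideanSpace ℝ (Fin 2)) : planeCoord x = (x 0, x 1) := rfl

lemma volume_image_planeCoord {s : Set (EuclideanSpace ℝ (Fin 2))} :
    volume (planeCoord '' s) = volume s := by
  have h : MeasurePreserving planeCoord :=
    (volume_preserving_finTwoArrow ℝ).comp (PiLp.volume_preserving_ofLp (Fin 2))
  have he : MeasurableEmbedding planeCoord := planeCoord.toHomeomorph.measurableEmbedding
  rw [← h.measure_preimage_emb he, Set.preimage_image_eq _ planeCoord.injective]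

open Pointwise in
lemma volume_add_segment_le {K : Set (EuclideanSpace ℝ (Fin 2))} (hK : IsCompact K)
    (hconv : Convex ℝ K) (u : EuclideanSpace ℝ (Fin 2))
    {m c : ℝ} (hm : ∀ x ∈ K, planeDet u x ∈ Set.Icc m (m + c)) :
    volume (K + segment ℝ 0 u) ≤ volume K + ENNReal.ofReal c := by
  by_cases hu : u = 0
  · simp [hu]
  have hN : u 0 ^ 2 + u 1 ^ 2 ≠ 0 := by
    have := EuclideanSpace.real_norm_sq_eq u
    rw [Fin.sum_univ_two] at this
    rw [← this]
    simpa using hu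
  set N := u 0 ^ 2 + u 1 ^ 2 with hNdef
  set S := planeMap (u 0 / N) (u 1 / N) (-u 1) (u 0) with hS
  have hdet : LinearMap.det S = 1 := by
    rw [hS, det_planeMap]
    field_simp
    rw [hNdef]
    ring
  set T : EuclideanSpace ℝ (Fin 2) →ₗ[ℝ] ℝ × ℝ := planeCoord.toLinearMap ∘ₗ S with hT
  have hTapply (x : EuclideanSpace ℝ (Fin 2)) :
      T x = (u 0 / N * x 0 + u 1 / N * x 1, planeDet u x) := by
    simp only [hT, LinearMap.comp_apply]
    change planeCoord (S x) = _
    rw [planeCoord_apply, hS, planeMap_apply_zero, planeMap_apply_one, planeDet]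
    ring_nf
  have hvol (s : Set (EuclideanSpace ℝ (Fin 2))) : volume (T '' s) = volume s := by
    have : T '' s = planeCoord '' (S '' s) := by rw [Set.image_image]; rfl
    rw [this, volume_image_planeCoord, Measure.addHaar_image_linearMap, hdet]
    simp
  have hTu : T u = (1, 0) := by
    rw [hTapply, planeDet]
    ext
    · simp only
      field_simp
      rw [hNdef]
    · simp only
      ring
  have himage : T '' segment ℝ 0 u = segment ℝ 0 (1, 0) := by
    rw [← hTu, ← map_zero T]
    exact image_segment ℝ T.toAffineMap 0 u
  rw [← hvol, ← hvol K, Set.image_add, himage]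
  refine volume_add_horizontal_segment_le (hK.image T.continuous_of_finiteDimensional)
    (hconv.linear_image T) (m := m) ?_
  rintro _ ⟨x, hx, rfl⟩
  rw [hTapply]
  exact hm x hx

lemma planeDet_self (x : EuclideanSpace ℝ (Fin 2)) : planeDet x x = 0 := by
  rw [planeDet]; ring

lemma planeDet_swap (x y : EuclideanSpace ℝ (Fin 2)) : planeDet y x = -planeDet x y := by
  rw [planeDet, planeDet]; ring

lemma planeDet_sum_smul {ι : Type*} (s : Finset ι) (x : EuclideanSpace ℝ (Fin 2)) (t : ι → ℝ)
    (v : ι → EuclideanSpace ℝ (Fin 2)) :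
    planeDet x (∑ i ∈ s, t i • v i) = ∑ i ∈ s, t i * planeDet x (v i) := by
  simp only [planeDet, WithLp.ofLp_sum, WithLp.ofLp_smul, Finset.sum_apply, Pi.smul_apply,
    smul_eq_mul, Finset.mul_sum, ← Finset.sum_sub_distrib]
  exact Finset.sum_congr rfl fun i _ => by ring

open Pointwise in
lemma volume_sum_segment_le {ι : Type*} (s : Finset ι) (v : ι → EuclideanSpace ℝ (Fin 2)) :
    volume (∑ i ∈ s, segment ℝ 0 (v i)) ≤
      ENNReal.ofReal ((∑ i ∈ s, ∑ j ∈ s, |planeDet (v i) (v j)|) / 2) := by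
  classical
  induction s using Finset.induction_on with
  | empty => exact (measure_singleton (0 : EuclideanSpace ℝ (Fin 2))).trans_le zero_le
  | insert a s ha ih =>
    have hcompact : IsCompact (∑ i ∈ s, segment ℝ 0 (v i)) := by
      refine Finset.sum_induction _ IsCompact (fun _ _ => IsCompact.add) isCompact_singleton
        fun i _ => ?_
      rw [segment_eq_image]
      exact isCompact_Icc.image (by fun_prop)
    have hconv : Convex ℝ (∑ i ∈ s, segment ℝ 0 (v i)) :=
      convex_sum _ fun i _ => convex_segment _ _
    rw [Finset.sum_insert ha, add_comm]
    refine (volume_add_segment_le hcompact hconv (v a)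
      (m := ∑ i ∈ s, min 0 (planeDet (v a) (v i)))
      (c := ∑ i ∈ s, |planeDet (v a) (v i)|) ?_).trans ?_
    · intro x hx
      rw [Set.mem_finsetSum] at hx
      obtain ⟨g, hg, rfl⟩ := hx
      simp only [segment_eq_image, smul_zero, zero_add] at hg
      choose! t ht htg using fun i (hi : i ∈ s) => hg hi
      rw [← Finset.sum_congr rfl htg, planeDet_sum_smul, ← Finset.sum_add_distrib]
      constructor <;> refine Finset.sum_le_sum fun i hi => ?_ <;>
        obtain ⟨h0, h1⟩ := ht i hi <;>
        rcases le_total 0 (planeDet (v a) (v i)) with h | h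
      · rw [min_eq_left h]; positivity
      · rw [min_eq_right h]; nlinarith
      · rw [min_eq_left h, abs_of_nonneg h]; nlinarith
      · rw [min_eq_right h, abs_of_nonpos h]; nlinarith
    · refine (add_le_add_left ih _).trans ?_
      rw [← ENNReal.ofReal_add (by positivity) (by positivity)]
      refine ENNReal.ofReal_le_ofReal (le_of_eq ?_)
      simp only [Finset.sum_insert ha, planeDet_self, abs_zero, Finset.sum_add_distrib,
        planeDet_swap (v a), abs_neg]
      ring

lemma norm_le_abs_add_abs (x : EuclideanSpace ℝ (Fin 2)) : ‖x‖ ≤ |x 0| + |x 1| := by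
  rw [EuclideanSpace.norm_eq, Fin.sum_univ_two]
  refine Real.sqrt_le_iff.mpr ⟨by positivity, ?_⟩
  simp only [Real.norm_eq_abs]
  nlinarith [abs_nonneg (x 0), abs_nonneg (x 1)]

lemma planeDet_add_smul_sub (a b : ℝ) (p q : EuclideanSpace ℝ (Fin 2)) :
    planeDet (a • (p + q)) (b • (p - q)) = -(2 * a * b * planeDet p q) := by
  simp only [planeDet, PiLp.smul_apply, PiLp.add_apply, PiLp.sub_apply, smul_eq_mul]
  ring

lemma volume_parallelepiped_pair (x y : EuclideanSpace ℝ (Fin 2)) :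
    volume (parallelepiped ![x, y]) = ENNReal.ofReal |planeDet x y| := by
  have h : (![x, y] : Fin 2 → EuclideanSpace ℝ (Fin 2)) =
      planeMap (x 0) (y 0) (x 1) (y 1) ∘ EuclideanSpace.basisFun (Fin 2) ℝ := by
    funext i
    ext j
    fin_cases i <;> fin_cases j <;> simp [planeMap_apply_zero, planeMap_apply_one]
  rw [h, ← image_parallelepiped, Measure.addHaar_image_linearMap,
    OrthonormalBasis.volume_parallelepiped, det_planeMap, mul_one, planeDet]
  ring_nf

section

variable {ι : Type*} [Fintype ι]

/-- A parallelogram with diagonals `p = ∑ sᵢ uᵢ` and `q = ∑ tᵢ uᵢ`, where all `|sᵢ|, |tᵢ| ≤ 1`,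
fits inside the zonogon. -/
lemma ofReal_planeDet_le_volume_parallelepiped (u : ι → EuclideanSpace ℝ (Fin 2)) {s t : ι → ℝ}
    (hs : ∀ i, |s i| ≤ 1) (ht : ∀ i, |t i| ≤ 1) :
    ENNReal.ofReal (|planeDet (∑ i, s i • u i) (∑ i, t i • u i)| / 2) ≤
      volume (parallelepiped u) := by
  set p := ∑ i, s i • u i with hp
  set q := ∑ i, t i • u i with hq
  have hvol := volume_parallelepiped_pair ((1 / 2 : ℝ) • (p + q)) ((1 / 2 : ℝ) • (p - q))
  rw [planeDet_add_smul_sub, abs_neg, abs_mul] at hvol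
  have h2 : |(2 * (1 / 2) * (1 / 2) : ℝ)| * |planeDet p q| = |planeDet p q| / 2 := by
    norm_num
    ring
  rw [← h2, ← hvol, ← measure_preimage_add volume (-((1 / 2 : ℝ) • ((∑ i, u i) - p)))]
  refine measure_mono fun x hx => ?_
  rw [Set.mem_preimage, mem_parallelepiped_iff] at hx
  obtain ⟨τ, ⟨hτ0, hτ1⟩, hx⟩ := hx
  rw [Fin.sum_univ_two, Matrix.cons_val_zero, Matrix.cons_val_one, Matrix.cons_val_fin_one,
    neg_add_eq_iff_eq_add] at hx
  rw [mem_parallelepiped_iff]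
  refine ⟨fun i => 1 / 2 * (1 + (τ 0 + τ 1 - 1) * s i + (τ 0 - τ 1) * t i), ?_, ?_⟩
  · have h (i : ι) : |(τ 0 + τ 1 - 1) * s i + (τ 0 - τ 1) * t i| ≤ 1 := by
      have h00 := hτ0 0
      have h01 := hτ0 1
      have h10 := hτ1 0
      have h11 := hτ1 1
      simp only [Pi.zero_apply, Pi.one_apply] at h00 h01 h10 h11
      calc _ ≤ |τ 0 + τ 1 - 1| * |s i| + |τ 0 - τ 1| * |t i| := by
            rw [← abs_mul, ← abs_mul]
            exact abs_add_le _ _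
        _ ≤ |τ 0 + τ 1 - 1| * 1 + |τ 0 - τ 1| * 1 := by
            gcongr
            exacts [hs i, ht i]
        _ ≤ 1 := by
            rcases abs_cases (τ 0 + τ 1 - 1) with ⟨h, _⟩ | ⟨h, _⟩ <;>
              rcases abs_cases (τ 0 - τ 1) with ⟨h', _⟩ | ⟨h', _⟩ <;> rw [h, h'] <;> linarith
    constructor <;> intro i <;> obtain ⟨ha, hb⟩ := abs_le.mp (h i) <;>
      simp only [Pi.zero_apply, Pi.one_apply] <;> linarith
  · have hsum : ∑ i, (1 / 2 * (1 + (τ 0 + τ 1 - 1) * s i + (τ 0 - τ 1) * t i)) • u i =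
        (1 / 2 : ℝ) • ((∑ i, u i) + (τ 0 + τ 1 - 1) • p + (τ 0 - τ 1) • q) := by
      simp only [hp, hq, Finset.smul_sum, ← Finset.sum_add_distrib]
      exact Finset.sum_congr rfl fun i _ => by module
    rw [hx, hsum]
    module

lemma sum_abs_planeDet_eq (u : ι → EuclideanSpace ℝ (Fin 2)) (x : EuclideanSpace ℝ (Fin 2)) :
    ∃ t : ι → ℝ, (∀ i, |t i| ≤ 1) ∧
      ∑ i, |planeDet x (u i)| = planeDet x (∑ i, t i • u i) := by
  refine ⟨fun i => SignType.sign (planeDet x (u i)), fun i => ?_, ?_⟩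
  · rcases lt_trichotomy (planeDet x (u i)) 0 with h | h | h <;> simp [h]
  · rw [planeDet_sum_smul]
    exact Finset.sum_congr rfl fun i _ => (sign_mul_self _).symm

/-- In the nondegenerate case, the linear map sending the diagonals of a maximal inscribed
parallelogram to orthogonal vectors of equal length makes the vectors short. -/
lemma exists_sum_norm_le_of_isMax (u : ι → EuclideanSpace ℝ (Fin 2))
    {p q : EuclideanSpace ℝ (Fin 2)} (hpos : 0 < planeDet p q)
    (hp : ∀ t : ι → ℝ, (∀ i, |t i| ≤ 1) → planeDet p (∑ i, t i • u i) ≤ planeDet p q)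
    (hq : ∀ t : ι → ℝ, (∀ i, |t i| ≤ 1) → planeDet q (∑ i, t i • u i) ≤ planeDet p q) :
    ∃ A : EuclideanSpace ℝ (Fin 2) →ₗ[ℝ] EuclideanSpace ℝ (Fin 2),
      LinearMap.det A = 1 ∧ ∑ i, ‖A (u i)‖ ≤ 2 * √(planeDet p q) := by
  set d := planeDet p q with hd
  set r := √d with hr
  have hrpos : 0 < r := Real.sqrt_pos.mpr hpos
  have hrr : r * r = d := Real.mul_self_sqrt hpos.le
  refine ⟨planeMap (q 1 / r) (-q 0 / r) (-p 1 / r) (p 0 / r), ?_, ?_⟩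
  · rw [det_planeMap]
    field_simp
    rw [sq, hrr, hd, planeDet]
    ring
  · have hle (i : ι) : ‖planeMap (q 1 / r) (-q 0 / r) (-p 1 / r) (p 0 / r) (u i)‖ ≤
        (|planeDet q (u i)| + |planeDet p (u i)|) / r := by
      refine (norm_le_abs_add_abs _).trans_eq ?_
      rw [planeMap_apply_zero, planeMap_apply_one, add_div, ← abs_of_pos hrpos, ← abs_div,
        ← abs_div, abs_of_pos hrpos, ← abs_neg, planeDet, planeDet]
      congr 2 <;> ring
    refine (Finset.sum_le_sum fun i _ => hle i).trans ?_
    obtain ⟨t, ht, hpt⟩ := sum_abs_planeDet_eq u p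
    obtain ⟨t', ht', hqt⟩ := sum_abs_planeDet_eq u q
    rw [← Finset.sum_div, Finset.sum_add_distrib, hpt, hqt, div_le_iff₀ hrpos, mul_assoc, hrr]
    linarith [hp t ht, hq t' ht']

/-- Vectors on a common line become arbitrarily short under maps of determinant one. -/
lemma exists_sum_norm_le_of_planeDet_eq_zero (u : ι → EuclideanSpace ℝ (Fin 2))
    (hdet : ∀ i j, planeDet (u i) (u j) = 0) {ε : ℝ} (hε : 0 < ε) :
    ∃ A : EuclideanSpace ℝ (Fin 2) →ₗ[ℝ] EuclideanSpace ℝ (Fin 2),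
      LinearMap.det A = 1 ∧ ∑ i, ‖A (u i)‖ ≤ ε := by
  by_cases hu : ∀ i, u i = 0
  · exact ⟨LinearMap.id, LinearMap.det_id, by simp [hu, hε.le]⟩
  push Not at hu
  obtain ⟨k, hk⟩ := hu
  set w := u k with hw
  have hN : w 0 ^ 2 + w 1 ^ 2 ≠ 0 := by
    have := EuclideanSpace.real_norm_sq_eq w
    rw [Fin.sum_univ_two] at this
    rw [← this]
    simpa using hk
  set C := ∑ i, |w 0 * u i 0 + w 1 * u i 1| with hC
  have hC0 : 0 ≤ C := by positivity
  set δ := ε / (C + 1) with hδ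
  have hδpos : 0 < δ := by positivity
  refine ⟨planeMap (δ * w 0) (δ * w 1) (-w 1 / (δ * (w 0 ^ 2 + w 1 ^ 2)))
    (w 0 / (δ * (w 0 ^ 2 + w 1 ^ 2))), ?_, ?_⟩
  · rw [det_planeMap]
    field_simp
    ring
  · have hle (i : ι) : ‖planeMap (δ * w 0) (δ * w 1) (-w 1 / (δ * (w 0 ^ 2 + w 1 ^ 2)))
        (w 0 / (δ * (w 0 ^ 2 + w 1 ^ 2))) (u i)‖ ≤ δ * |w 0 * u i 0 + w 1 * u i 1| := by
      refine (norm_le_abs_add_abs _).trans_eq ?_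
      have h1 : -w 1 / (δ * (w 0 ^ 2 + w 1 ^ 2)) * u i 0 +
          w 0 / (δ * (w 0 ^ 2 + w 1 ^ 2)) * u i 1 =
          planeDet w (u i) / (δ * (w 0 ^ 2 + w 1 ^ 2)) := by
        rw [planeDet]
        ring
      rw [planeMap_apply_zero, planeMap_apply_one, h1, hdet, zero_div, abs_zero, add_zero,
        mul_assoc, mul_assoc, ← mul_add, abs_mul, abs_of_pos hδpos]
    refine (Finset.sum_le_sum fun i _ => hle i).trans ?_
    rw [← Finset.mul_sum, ← hC, hδ, div_mul_eq_mul_div, div_le_iff₀ (by linarith)]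
    nlinarith

lemma exists_max_planeDet (u : ι → EuclideanSpace ℝ (Fin 2)) :
    ∃ s t : ι → ℝ, (∀ i, |s i| ≤ 1) ∧ (∀ i, |t i| ≤ 1) ∧
      ∀ s' t' : ι → ℝ, (∀ i, |s' i| ≤ 1) → (∀ i, |t' i| ≤ 1) →
        planeDet (∑ i, s' i • u i) (∑ i, t' i • u i) ≤
          planeDet (∑ i, s i • u i) (∑ i, t i • u i) := by
  have hmem (f : ι → ℝ) : f ∈ Set.Icc (-1 : ι → ℝ) 1 ↔ ∀ i, |f i| ≤ 1 := by
    simp only [Set.mem_Icc, Pi.le_def, Pi.neg_apply, Pi.one_apply, abs_le, forall_and]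
  have hcont : Continuous fun f : (ι → ℝ) × (ι → ℝ) =>
      planeDet (∑ i, f.1 i • u i) (∑ i, f.2 i • u i) := by
    unfold planeDet
    fun_prop
  obtain ⟨⟨s, t⟩, hst, hmax⟩ := ((isCompact_Icc (a := (-1 : ι → ℝ)) (b := 1)).prod
    (isCompact_Icc (a := (-1 : ι → ℝ)) (b := 1))).exists_isMaxOn
    ⟨(0, 0), by simp⟩ hcont.continuousOn
  refine ⟨s, t, (hmem s).mp hst.1, (hmem t).mp hst.2, fun s' t' hs' ht' => ?_⟩
  exact hmax (a := (s', t')) ⟨(hmem s').mpr hs', (hmem t').mpr ht'⟩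

lemma planeDet_sum_neg_smul (u : ι → EuclideanSpace ℝ (Fin 2)) (x : EuclideanSpace ℝ (Fin 2))
    (t : ι → ℝ) : planeDet (∑ i, t i • u i) x = planeDet x (∑ i, (-t i) • u i) := by
  rw [planeDet_swap x, planeDet_sum_smul, planeDet_sum_smul]
  simp

/-- A zonogon of area `a` has, up to an error `ε`, a unimodular image of half-perimeter at most
`√(8 a)`. -/
lemma exists_sum_norm_le (u : ι → EuclideanSpace ℝ (Fin 2)) {ε : ℝ} (hε : 0 < ε) :
    ∃ A : EuclideanSpace ℝ (Fin 2) →ₗ[ℝ] EuclideanSpace ℝ (Fin 2),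
      LinearMap.det A = 1 ∧
        ∑ i, ‖A (u i)‖ ≤ √(8 * (volume (parallelepiped u)).toReal) + ε := by
  classical
  obtain ⟨s, t, hs, ht, hmax⟩ := exists_max_planeDet u
  have hnonneg : 0 ≤ planeDet (∑ i, s i • u i) (∑ i, t i • u i) := by
    simpa [planeDet] using hmax 0 0 (by simp) (by simp)
  rcases hnonneg.eq_or_lt with h0 | hpos
  · have hle (i j : ι) : planeDet (u i) (u j) ≤ 0 := by
      have hsingle (k l : ι) : |(Pi.single k (1 : ℝ) : ι → ℝ) l| ≤ 1 := by
        rcases eq_or_ne l k with rfl | h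
        · simp
        · simp [h]
      have := hmax (Pi.single i 1) (Pi.single j 1) (hsingle i) (hsingle j)
      simpa [Pi.single_apply, ← h0] using this
    obtain ⟨A, hA, hAu⟩ := exists_sum_norm_le_of_planeDet_eq_zero u
      (fun i j => le_antisymm (hle i j) (by linarith [hle j i, planeDet_swap (u i) (u j)])) hε
    exact ⟨A, hA, hAu.trans (le_add_of_nonneg_left (Real.sqrt_nonneg _))⟩
  · obtain ⟨A, hA, hAu⟩ := exists_sum_norm_le_of_isMax u hpos (fun t' ht' => hmax s t' hs ht')
      (fun t' ht' => by
        have := hmax (-t') t (fun i => by simpa using ht' i) ht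
        rw [planeDet_sum_neg_smul] at this
        simpa using this)
    refine ⟨A, hA, hAu.trans ?_⟩
    have hfin : volume (parallelepiped u) ≠ ⊤ := by
      rw [parallelepiped_eq_sum_segment]
      exact ((volume_sum_segment_le _ u).trans_lt ENNReal.ofReal_lt_top).ne
    have harea := ofReal_planeDet_le_volume_parallelepiped u hs ht
    rw [ENNReal.ofReal_le_iff_le_toReal hfin, abs_of_pos hpos] at harea
    have : 2 * √(planeDet (∑ i, s i • u i) (∑ i, t i • u i)) ≤
        √(8 * (volume (parallelepiped u)).toReal) := by
      refine Real.le_sqrt_of_sq_le ?_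
      rw [mul_pow, Real.sq_sqrt hnonneg]
      linarith
    linarith

lemma pi_mul_volume_parallelepiped_le (u : ι → EuclideanSpace ℝ (Fin 2)) :
    Real.pi * (volume (parallelepiped u)).toReal ≤ (∑ i, ‖u i‖) ^ 2 := by
  have h := volume_sum_segment_le Finset.univ u
  rw [← parallelepiped_eq_sum_segment] at h
  have h1 := ENNReal.toReal_le_of_le_ofReal (by positivity) h
  have h2 := sum_abs_planeDet_le Finset.univ u
  rw [div_mul_eq_mul_div, le_div_iff₀ Real.pi_pos] at h2
  nlinarith [Real.pi_pos]

end

/-- Planar form of Proposition 6.6: if `Z` is the zonogon associated to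
`u₁, …, u_k ∈ ℝ²`, `area(Z)` its Lebesgue measure, and
`L = inf {∑ ‖A uᵢ‖ : A linear of determinant 1}`, then
`π·area(Z) ≤ L² ≤ 8·area(Z)`. -/
theorem zonogon_area_vs_min_length
    (k : ℕ) (u : Fin k → EuclideanSpace ℝ (Fin 2))
    (Z : Set (EuclideanSpace ℝ (Fin 2)))
    (hZ : Z = {x | ∃ t : Fin k → ℝ,
      (∀ i, 0 ≤ t i ∧ t i ≤ 1) ∧ x = ∑ i, t i • u i})
    (L : ℝ)
    (hL : L = sInf {s : ℝ |
      ∃ A : EuclideanSpace ℝ (Fin 2) →ₗ[ℝ] EuclideanSpace ℝ (Fin 2),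
        LinearMap.det A = 1 ∧ s = ∑ i, ‖A (u i)‖}) :
    Real.pi * (volume Z).toReal ≤ L ^ 2 ∧
    L ^ 2 ≤ 8 * (volume Z).toReal := by
  have hZu : Z = parallelepiped u := by
    rw [hZ]
    ext x
    simp only [mem_parallelepiped_iff, Set.mem_Icc, Pi.le_def, Pi.zero_apply, Pi.one_apply,
      ← forall_and, Set.mem_ofPred_eq]
  have hL0 : 0 ≤ L := by
    rw [hL]
    refine Real.sInf_nonneg ?_
    rintro _ ⟨A, -, rfl⟩
    positivity
  rw [hZu]
  constructor
  · rw [← Real.sqrt_le_left hL0, hL]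
    refine le_csInf ⟨_, LinearMap.id, LinearMap.det_id, rfl⟩ ?_
    rintro _ ⟨A, hA, rfl⟩
    refine Real.sqrt_le_iff.mpr ⟨by positivity, ?_⟩
    have h := pi_mul_volume_parallelepiped_le (A ∘ u)
    rwa [← image_parallelepiped, Measure.addHaar_image_linearMap, hA, abs_one,
      ENNReal.ofReal_one, one_mul] at h
  · rw [← Real.le_sqrt hL0 (by positivity)]
    refine le_of_forall_pos_le_add fun ε hε => ?_
    obtain ⟨A, hA, hAu⟩ := exists_sum_norm_le u hε
    refine le_trans ?_ hAu
    rw [hL]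
    refine csInf_le ⟨0, ?_⟩ ⟨A, hA, rfl⟩
    rintro _ ⟨B, -, rfl⟩
    positivity
end

section
/- Let u₁, …, u_k ∈ ℝ² and let L = inf{∑ᵢ ‖A uᵢ‖ : A a linear map ℝ² → ℝ² with determinant 1}, where ‖·‖ is the Euclidean norm. Then L = 0 if and only if all the vectors uᵢ lie on a common line through the origin, i.e. there exists v ∈ ℝ² such that every uᵢ is a scalar multiple of v. -/
/-- The determinant of a pair of plane vectors in the standard basis. -/
theorem det_basisFun_fin_two (x y : EuclideanSpace ℝ (Fin 2)) :
    (EuclideanSpace.basisFun (Fin 2) ℝ).toBasis.det ![x, y] = x 0 * y 1 - x 1 * y 0 := by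
  simp [Module.Basis.det_apply, Matrix.det_fin_two, Module.Basis.toMatrix_apply]
  ring

/-- A linear endomorphism of the plane multiplies the area of a parallelogram by its
determinant. -/
theorem cross_map_eq_det_mul (A : EuclideanSpace ℝ (Fin 2) →ₗ[ℝ] EuclideanSpace ℝ (Fin 2))
    (x y : EuclideanSpace ℝ (Fin 2)) :
    A x 0 * A y 1 - A x 1 * A y 0 = LinearMap.det A * (x 0 * y 1 - x 1 * y 0) := by
  have h := (EuclideanSpace.basisFun (Fin 2) ℝ).toBasis.det_comp A ![x, y]
  have hxy : A ∘ ![x, y] = ![A x, A y] := by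
    ext i
    fin_cases i <;> rfl
  rwa [hxy, det_basisFun_fin_two, det_basisFun_fin_two] at h

/-- The area of a parallelogram is at most the product of its side lengths. -/
theorem abs_cross_le_norm_mul_norm (x y : EuclideanSpace ℝ (Fin 2)) :
    |x 0 * y 1 - x 1 * y 0| ≤ ‖x‖ * ‖y‖ := by
  refine abs_le_of_sq_le_sq ?_ (by positivity)
  rw [mul_pow, EuclideanSpace.real_norm_sq_eq, EuclideanSpace.real_norm_sq_eq,
    Fin.sum_univ_two, Fin.sum_univ_two]
  nlinarith [sq_nonneg (x 0 * y 0 + x 1 * y 1)]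

/-- Plane vectors spanning no area with a nonzero vector are multiples of it. -/
theorem exists_eq_smul_of_cross_eq_zero {x v : EuclideanSpace ℝ (Fin 2)} (hv : v ≠ 0)
    (h : x 0 * v 1 - x 1 * v 0 = 0) : ∃ c : ℝ, x = c • v := by
  by_cases h0 : v 0 = 0
  · have h1 : v 1 ≠ 0 := fun h1 => hv (by ext i; fin_cases i <;> simp [h0, h1])
    refine ⟨x 1 / v 1, ?_⟩
    have hx : x 0 = 0 := by simpa [h0, h1] using h
    ext i
    fin_cases i <;> simp [h0, h1, hx]
  · refine ⟨x 0 / v 0, ?_⟩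
    ext i
    fin_cases i
    · simp [h0]
    · simp only [Fin.mk_one, PiLp.smul_apply, smul_eq_mul]
      field_simp
      linarith

/-- A nonzero plane vector can be given any positive length by a map of determinant one. -/
theorem exists_det_eq_one_norm_map_eq {v : EuclideanSpace ℝ (Fin 2)} (hv : v ≠ 0)
    {t : ℝ} (ht : 0 < t) :
    ∃ A : EuclideanSpace ℝ (Fin 2) →ₗ[ℝ] EuclideanSpace ℝ (Fin 2),
      LinearMap.det A = 1 ∧ ‖A v‖ = t := by
  have hn : v 0 ^ 2 + v 1 ^ 2 ≠ 0 := by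
    have := EuclideanSpace.real_norm_sq_eq v
    rw [Fin.sum_univ_two] at this
    rw [← this]
    simpa using hv
  let b := (EuclideanSpace.basisFun (Fin 2) ℝ).toBasis
  let M : Matrix (Fin 2) (Fin 2) ℝ :=
    !![t * v 0 / (v 0 ^ 2 + v 1 ^ 2), t * v 1 / (v 0 ^ 2 + v 1 ^ 2); -v 1 / t, v 0 / t]
  refine ⟨Matrix.toLin b b M, ?_, ?_⟩
  · rw [LinearMap.det_toLin, Matrix.det_fin_two_of]
    field_simp
    ring
  · have hM : Matrix.toLin b b M v = !₂[t, 0] := by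
      ext i
      fin_cases i
      · simp [Matrix.toLin_apply, b, M, Matrix.mulVec, dotProduct, Fin.sum_univ_two]
        field_simp
      · simp [Matrix.toLin_apply, b, M, Matrix.mulVec, dotProduct, Fin.sum_univ_two]
        field_simp
        ring
    rw [hM, EuclideanSpace.norm_eq]
    simp [Fin.sum_univ_two, Real.sqrt_sq ht.le]

/-- Planar form of the second assertion of Proposition 6.6: the infimum
`L = inf {∑ ‖A uᵢ‖ : A linear of determinant 1}` vanishes if and only if all
the vectors `uᵢ` lie on a common line through the origin. -/
theorem min_length_zero_iff_parallel
    (k : ℕ) (u : Fin k → EuclideanSpace ℝ (Fin 2))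
    (L : ℝ)
    (hL : L = sInf {s : ℝ |
      ∃ A : EuclideanSpace ℝ (Fin 2) →ₗ[ℝ] EuclideanSpace ℝ (Fin 2),
        LinearMap.det A = 1 ∧ s = ∑ i, ‖A (u i)‖}) :
    L = 0 ↔ ∃ v : EuclideanSpace ℝ (Fin 2), ∀ i, ∃ c : ℝ, u i = c • v := by
  set S : Set ℝ := {s : ℝ |
      ∃ A : EuclideanSpace ℝ (Fin 2) →ₗ[ℝ] EuclideanSpace ℝ (Fin 2),
        LinearMap.det A = 1 ∧ s = ∑ i, ‖A (u i)‖}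
  have hne : S.Nonempty := ⟨_, LinearMap.id, LinearMap.det_id, rfl⟩
  have hnonneg : ∀ s ∈ S, 0 ≤ s := by
    rintro s ⟨A, -, rfl⟩
    positivity
  subst hL
  constructor
  · intro h0
    have hcross : ∀ i j, u i 0 * u j 1 - u i 1 * u j 0 = 0 := by
      intro i j
      by_contra hc
      obtain ⟨s, hs, hlt⟩ := exists_lt_of_csInf_lt hne
        (h0.trans_lt (Real.sqrt_pos.2 (abs_pos.2 hc)))
      have hs0 := hnonneg s hs
      obtain ⟨A, hA, rfl⟩ := hs
      have hle : ∀ l, ‖A (u l)‖ ≤ ∑ i, ‖A (u i)‖ := fun l =>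
        Finset.single_le_sum (f := fun i => ‖A (u i)‖) (fun _ _ => norm_nonneg _)
          (Finset.mem_univ l)
      have hb := abs_cross_le_norm_mul_norm (A (u i)) (A (u j))
      rw [cross_map_eq_det_mul, hA, one_mul] at hb
      have hsq := (Real.lt_sqrt hs0).1 hlt
      have := mul_le_mul (hle i) (hle j) (norm_nonneg _) hs0
      nlinarith
    by_cases hu : ∃ j, u j ≠ 0
    · obtain ⟨j, hj⟩ := hu
      exact ⟨u j, fun i => exists_eq_smul_of_cross_eq_zero hj (hcross i j)⟩
    · push Not at hu
      exact ⟨0, fun i => ⟨0, by simp [hu i]⟩⟩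
  · rintro ⟨v, hv⟩
    choose c hc using hv
    refine le_antisymm (le_of_forall_pos_le_add fun ε hε => ?_) (le_csInf hne hnonneg)
    rw [zero_add]
    have hC : 0 ≤ ∑ i, |c i| := by positivity
    have hsum : ∀ A : EuclideanSpace ℝ (Fin 2) →ₗ[ℝ] EuclideanSpace ℝ (Fin 2),
        ∑ i, ‖A (u i)‖ = (∑ i, |c i|) * ‖A v‖ := by
      intro A
      simp [hc, norm_smul, Finset.sum_mul]
    suffices h : ∃ A : EuclideanSpace ℝ (Fin 2) →ₗ[ℝ] EuclideanSpace ℝ (Fin 2),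
        LinearMap.det A = 1 ∧ (∑ i, |c i|) * ‖A v‖ ≤ ε by
      obtain ⟨A, hA, hle⟩ := h
      exact (csInf_le ⟨0, hnonneg⟩ ⟨A, hA, rfl⟩).trans ((hsum A).trans_le hle)
    by_cases hv0 : v = 0
    · exact ⟨LinearMap.id, LinearMap.det_id, by simpa [hv0] using hε.le⟩
    · obtain ⟨A, hA, hAv⟩ := exists_det_eq_one_norm_map_eq hv0
        (show 0 < ε / (1 + ∑ i, |c i|) by positivity)
      refine ⟨A, hA, ?_⟩
      rw [hAv, mul_div_assoc', div_le_iff₀ (by positivity)]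
      nlinarith
end

section
/- Let u₁, …, u_k ∈ ℝ² be vectors that span ℝ², and let L = inf{∑ᵢ ‖A uᵢ‖ : A a linear map ℝ² → ℝ² with determinant 1}, where ‖·‖ is the Euclidean norm. Then the infimum is attained: there exists a linear map A₀ with determinant 1 such that ∑ᵢ ‖A₀ uᵢ‖ = L. Moreover the minimiser is unique up to rotation: if A₁ and A₂ both have determinant 1 and satisfy ∑ᵢ ‖A₁ uᵢ‖ = L = ∑ᵢ ‖A₂ uᵢ‖, then A₂ ∘ A₁⁻¹ is a rotation (an orthogonal linear map of determinant 1). -/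
/-- The linear endomorphism of the Euclidean plane with matrix `!![a, b; c, d]`. -/
noncomputable def planarMap (a b c d : ℝ) :
    EuclideanSpace ℝ (Fin 2) →ₗ[ℝ] EuclideanSpace ℝ (Fin 2) :=
  Matrix.toLin (EuclideanSpace.basisFun (Fin 2) ℝ).toBasis
    (EuclideanSpace.basisFun (Fin 2) ℝ).toBasis !![a, b; c, d]

lemma det_planarMap (a b c d : ℝ) : LinearMap.det (planarMap a b c d) = a * d - b * c := by
  rw [planarMap, LinearMap.det_toLin, Matrix.det_fin_two_of]

lemma exists_eq_planarMap (B : EuclideanSpace ℝ (Fin 2) →ₗ[ℝ] EuclideanSpace ℝ (Fin 2)) :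
    ∃ a b c d : ℝ, B = planarMap a b c d := by
  set e := (EuclideanSpace.basisFun (Fin 2) ℝ).toBasis with he
  refine ⟨LinearMap.toMatrix e e B 0 0, LinearMap.toMatrix e e B 0 1,
    LinearMap.toMatrix e e B 1 0, LinearMap.toMatrix e e B 1 1, ?_⟩
  rw [planarMap, ← Matrix.eta_fin_two, ← he, Matrix.toLin_toMatrix]

lemma planarMap_comp (a b c d a' b' c' d' : ℝ) :
    planarMap a b c d ∘ₗ planarMap a' b' c' d' =
      planarMap (a * a' + b * c') (a * b' + b * d') (c * a' + d * c') (c * b' + d * d') := by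
  simp only [planarMap]
  rw [← Matrix.toLin_mul, Matrix.mul_fin_two]

lemma id_add_planarMap (a b c d : ℝ) :
    LinearMap.id + planarMap a b c d = planarMap (1 + a) b c (1 + d) := by
  rw [planarMap, planarMap, ← Matrix.toLin_one (EuclideanSpace.basisFun (Fin 2) ℝ).toBasis,
    ← map_add, Matrix.one_fin_two]
  simp

lemma norm_planarMap_rotation {p q : ℝ} (h : p ^ 2 + q ^ 2 = 1) (x : EuclideanSpace ℝ (Fin 2)) :
    ‖planarMap p (-q) q p x‖ = ‖x‖ := by
  have h0 : planarMap p (-q) q p x 0 = p * x 0 - q * x 1 := by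
    simp [planarMap, Matrix.toLin_apply, Matrix.mulVec, dotProduct, Fin.sum_univ_two,
      sub_eq_add_neg]
  have h1 : planarMap p (-q) q p x 1 = q * x 0 + p * x 1 := by
    simp [planarMap, Matrix.toLin_apply, Matrix.mulVec, dotProduct, Fin.sum_univ_two]
  rw [EuclideanSpace.norm_eq, EuclideanSpace.norm_eq, Fin.sum_univ_two, Fin.sum_univ_two, h0, h1]
  simp only [Real.norm_eq_abs, sq_abs]
  congr 1
  linear_combination (x 0 ^ 2 + x 1 ^ 2) * h

/-- A planar map `B` of determinant one is either an isometry, or some isometry `R` gives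
`det (id + R ∘ B) > 4`. -/
lemma isometry_or_exists_four_lt_det
    {B : EuclideanSpace ℝ (Fin 2) →ₗ[ℝ] EuclideanSpace ℝ (Fin 2)} (hB : LinearMap.det B = 1) :
    (∀ x, ‖B x‖ = ‖x‖) ∨
      ∃ R : EuclideanSpace ℝ (Fin 2) →ₗ[ℝ] EuclideanSpace ℝ (Fin 2),
        (∀ x, ‖R x‖ = ‖x‖) ∧ 4 < LinearMap.det (LinearMap.id + R ∘ₗ B) := by
  obtain ⟨a, b, c, d, rfl⟩ := exists_eq_planarMap B
  rw [det_planarMap] at hB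
  by_cases h : a = d ∧ b = -c
  · obtain ⟨rfl, rfl⟩ := h
    exact Or.inl (norm_planarMap_rotation (by linear_combination hB))
  right
  have hgt : 4 < (a + d) ^ 2 + (b - c) ^ 2 := by
    have hpos : 0 < (a - d) ^ 2 + (b + c) ^ 2 := by
      rcases not_and_or.mp h with h | h
      · have := sub_ne_zero.mpr h
        positivity
      · have : b + c ≠ 0 := fun h' => h (eq_neg_of_add_eq_zero_left h')
        positivity
    linear_combination hpos - 4 * hB
  set s := √((a + d) ^ 2 + (b - c) ^ 2) with hs
  have hs2 : s ^ 2 = (a + d) ^ 2 + (b - c) ^ 2 := Real.sq_sqrt (by positivity)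
  have hs_gt : 2 < s := Real.lt_sqrt_of_sq_lt (by linarith)
  have hs0 : s ≠ 0 := by positivity
  have hpq : ((a + d) / s) ^ 2 + ((b - c) / s) ^ 2 = 1 := by
    field_simp
    exact hs2.symm
  have htr : (a + d) / s * (a + d) + (b - c) / s * (b - c) = s := by
    field_simp
    linear_combination -hs2
  refine ⟨planarMap ((a + d) / s) (-((b - c) / s)) ((b - c) / s) ((a + d) / s),
    norm_planarMap_rotation hpq, ?_⟩
  rw [planarMap_comp, id_add_planarMap, det_planarMap]
  generalize (a + d) / s = p at *
  generalize (b - c) / s = q at *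
  have hdet : (1 + (p * a + -q * c)) * (1 + (q * b + p * d)) - (p * b + -q * d) * (q * a + p * c)
      = 2 + s := by
    linear_combination htr + (p ^ 2 + q ^ 2) * hB + hpq
  linarith

/-- On every nonempty closed set of linear maps, the sum of the norms of the values on a spanning
family attains its minimum. -/
lemma exists_isMinOn_sum_norm {E ι : Type*} [NormedAddCommGroup E] [NormedSpace ℝ E]
    [FiniteDimensional ℝ E] [Fintype ι] {u : ι → E}
    (hspan : Submodule.span ℝ (Set.range u) = ⊤) {S : Set (E →L[ℝ] E)} (hS : IsClosed S)
    (hne : S.Nonempty) : ∃ A ∈ S, IsMinOn (fun A : E →L[ℝ] E => ∑ i, ‖A (u i)‖) S A := by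
  obtain ⟨A₀, hA₀⟩ := hne
  let Φ : (E →L[ℝ] E) →ₗ[ℝ] (ι → E) :=
    { toFun := fun A i => A (u i)
      map_add' := fun _ _ => rfl
      map_smul' := fun _ _ => rfl }
  have hinj : LinearMap.ker Φ = ⊥ := by
    refine LinearMap.ker_eq_bot.mpr fun A B hAB => ContinuousLinearMap.coe_injective ?_
    exact LinearMap.ext_on_range hspan fun i => congrFun hAB i
  have htend : Filter.Tendsto (fun A : E →L[ℝ] E => ∑ i, ‖A (u i)‖)
      (Filter.cocompact _) Filter.atTop := by
    have hcl := (LinearMap.isClosedEmbedding_of_injective hinj).tendsto_cocompact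
    refine Filter.tendsto_atTop_mono (fun A => ?_)
      ((tendsto_norm_cocompact_atTop (E := ι → E)).comp hcl)
    refine (pi_norm_le_iff_of_nonneg (Finset.sum_nonneg fun i _ => norm_nonneg _)).mpr fun i => ?_
    exact Finset.single_le_sum (f := fun i => ‖A (u i)‖) (fun i _ => norm_nonneg _)
      (Finset.mem_univ i)
  exact ContinuousOn.exists_isMinOn' (by fun_prop) hS hA₀
    (Filter.Eventually.filter_mono inf_le_left (htend.eventually_ge_atTop _))

/-- Planar form of Lemma 2.7: if `u₁, …, u_k` span `ℝ²` and
`L = inf {∑ ‖A uᵢ‖ : A linear of determinant 1}`, then the infimum is attained,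
and any two minimisers differ by a rotation: if `A₁, A₂` are minimisers then
`A₂ ∘ A₁⁻¹` is an orthogonal linear map of determinant `1`, i.e. `A₂ = R ∘ A₁`
for a norm-preserving linear map `R` of determinant `1`. -/
theorem min_length_attained_unique
    (k : ℕ) (u : Fin k → EuclideanSpace ℝ (Fin 2))
    (hspan : Submodule.span ℝ (Set.range u) = ⊤)
    (L : ℝ)
    (hL : L = sInf {s : ℝ |
      ∃ A : EuclideanSpace ℝ (Fin 2) →ₗ[ℝ] EuclideanSpace ℝ (Fin 2),
        LinearMap.det A = 1 ∧ s = ∑ i, ‖A (u i)‖}) :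
    (∃ A₀ : EuclideanSpace ℝ (Fin 2) →ₗ[ℝ] EuclideanSpace ℝ (Fin 2),
        LinearMap.det A₀ = 1 ∧ ∑ i, ‖A₀ (u i)‖ = L) ∧
    (∀ A₁ A₂ : EuclideanSpace ℝ (Fin 2) →ₗ[ℝ] EuclideanSpace ℝ (Fin 2),
        LinearMap.det A₁ = 1 → LinearMap.det A₂ = 1 →
        ∑ i, ‖A₁ (u i)‖ = L → ∑ i, ‖A₂ (u i)‖ = L →
        ∃ R : EuclideanSpace ℝ (Fin 2) →ₗ[ℝ] EuclideanSpace ℝ (Fin 2),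
          (∀ x, ‖R x‖ = ‖x‖) ∧ LinearMap.det R = 1 ∧ A₂ = R ∘ₗ A₁) := by
  have hle : ∀ A : EuclideanSpace ℝ (Fin 2) →ₗ[ℝ] EuclideanSpace ℝ (Fin 2),
      LinearMap.det A = 1 → L ≤ ∑ i, ‖A (u i)‖ := by
    intro A hA
    rw [hL]
    refine csInf_le ⟨0, ?_⟩ ⟨A, hA, rfl⟩
    rintro _ ⟨_, _, rfl⟩
    positivity
  refine ⟨?_, ?_⟩
  · obtain ⟨A, hA, hmin⟩ := exists_isMinOn_sum_norm hspan
      (S := {A : EuclideanSpace ℝ (Fin 2) →L[ℝ] EuclideanSpace ℝ (Fin 2) | A.det = 1})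
      (isClosed_eq ContinuousLinearMap.continuous_det continuous_const)
      ⟨ContinuousLinearMap.id ℝ _, by simp [ContinuousLinearMap.det]⟩
    refine ⟨A, hA, le_antisymm ?_ (hle _ hA)⟩
    rw [hL]
    refine le_csInf ⟨_, A, hA, rfl⟩ ?_
    rintro _ ⟨B, hB, rfl⟩
    exact hmin (a := B.toContinuousLinearMap) (by simpa [ContinuousLinearMap.det] using hB)
  · intro A₁ A₂ h₁ h₂ hL₁ hL₂
    have hLpos : 0 < L := by
      refine (hL₁ ▸ Finset.sum_nonneg fun i _ => norm_nonneg _ : 0 ≤ L).lt_of_ne fun h0 => ?_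
      have hzero : A₁ = 0 := LinearMap.ext_on_range hspan fun i => by
        rw [← h0, Finset.sum_eq_zero_iff_of_nonneg fun i _ => norm_nonneg _] at hL₁
        simpa using hL₁ i (Finset.mem_univ i)
      simp [hzero] at h₁
    let e := LinearMap.equivOfDetNeZero A₁ (by simp [h₁])
    have he : (e : EuclideanSpace ℝ (Fin 2) →ₗ[ℝ] EuclideanSpace ℝ (Fin 2)) = A₁ := rfl
    obtain ⟨B, rfl⟩ : ∃ B, A₂ = B ∘ₗ A₁ :=
      ⟨A₂ ∘ₗ e.symm, by rw [← he, LinearMap.comp_assoc, LinearEquiv.symm_comp, LinearMap.comp_id]⟩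
    have hB : LinearMap.det B = 1 := by rwa [LinearMap.det_comp, h₁, mul_one] at h₂
    rcases isometry_or_exists_four_lt_det hB with hiso | ⟨R, hR, hdet⟩
    · exact ⟨B, hiso, hB, rfl⟩
    exfalso
    set C := (LinearMap.id + R ∘ₗ B) ∘ₗ A₁ with hC
    have hCdet : 4 < LinearMap.det C := by rwa [hC, LinearMap.det_comp, h₁, mul_one]
    have hCsum : ∑ i, ‖C (u i)‖ ≤ 2 * L := by
      calc ∑ i, ‖C (u i)‖ ≤ ∑ i, (‖A₁ (u i)‖ + ‖(B ∘ₗ A₁) (u i)‖) :=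
            Finset.sum_le_sum fun i _ => (norm_add_le _ _).trans_eq (by simp [hR])
        _ = 2 * L := by rw [Finset.sum_add_distrib, hL₁, hL₂, two_mul]
    set r := √(LinearMap.det C) with hr
    have hr2 : r ^ 2 = LinearMap.det C := Real.sq_sqrt (by linarith)
    have hr_gt : 2 < r := Real.lt_sqrt_of_sq_lt (by linarith)
    have hmin := hle (r⁻¹ • C) (by
      rw [LinearMap.det_smul, finrank_euclideanSpace_fin, ← hr2]
      field_simp)
    simp only [LinearMap.smul_apply, norm_smul, ← Finset.mul_sum] at hmin
    rw [Real.norm_of_nonneg (by positivity), inv_mul_eq_div, le_div_iff₀ (by positivity)] at hmin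
    nlinarith
end

section
/- Let u₁, …, u_k ∈ ℝ² with uᵢ = (aᵢ, bᵢ), and suppose at least one uᵢ is nonzero. Then the function f : ℝ → ℝ defined by f(t) = ∑ᵢ √(e^{2t}·aᵢ² + e^{-2t}·bᵢ²) is strictly convex on ℝ. -/
/-- The Euclidean length of the image of `(a, b)` under `diag(e^t, e^{-t})`, as the norm of a
complex number with nonnegative coordinates. -/
lemma sqrt_exp_mul_sq_add_eq_norm (a b t : ℝ) :
    √(Real.exp (2 * t) * a ^ 2 + Real.exp (-(2 * t)) * b ^ 2) =
      ‖(⟨Real.exp t * |a|, Real.exp (-t) * |b|⟩ : ℂ)‖ := by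
  rw [Complex.norm_eq_sqrt_sq_add_sq]
  simp only [mul_pow, sq_abs, ← Real.exp_nat_mul]
  congr 4
  push_cast
  ring_nf

/-- The flat length of a single nonzero vector is strictly convex along the flow
`diag(e^t, e^{-t})`. -/
lemma strictConvexOn_sqrt_exp_mul_sq_add {a b : ℝ} (h : a ≠ 0 ∨ b ≠ 0) :
    StrictConvexOn ℝ Set.univ
      fun t ↦ √(Real.exp (2 * t) * a ^ 2 + Real.exp (-(2 * t)) * b ^ 2) := by
  refine ⟨convex_univ, fun x _ y _ hxy p q hp hq hpq ↦ ?_⟩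
  have hexp : Real.exp (p * x + q * y) < p * Real.exp x + q * Real.exp y :=
    strictConvexOn_exp.2 (Set.mem_univ x) (Set.mem_univ y) hxy hp hq hpq
  have hexp_neg : Real.exp (-(p * x + q * y)) < p * Real.exp (-x) + q * Real.exp (-y) := by
    have := strictConvexOn_exp.2 (Set.mem_univ (-x)) (Set.mem_univ (-y))
      (neg_injective.ne hxy) hp hq hpq
    simpa only [smul_eq_mul, mul_neg, ← neg_add] using this
  simp only [sqrt_exp_mul_sq_add_eq_norm, smul_eq_mul]
  set v : ℂ := ⟨Real.exp x * |a|, Real.exp (-x) * |b|⟩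
  set w : ℂ := ⟨Real.exp y * |a|, Real.exp (-y) * |b|⟩
  calc
    _ < ‖(⟨(p * Real.exp x + q * Real.exp y) * |a|,
          (p * Real.exp (-x) + q * Real.exp (-y)) * |b|⟩ : ℂ)‖ := by
      simp only [Complex.norm_eq_sqrt_sq_add_sq]
      refine Real.sqrt_lt_sqrt (by positivity) ?_
      rcases h with ha | hb
      · have := abs_pos.2 ha
        refine add_lt_add_of_lt_of_le ?_ ?_ <;> gcongr
      · have := abs_pos.2 hb
        refine add_lt_add_of_le_of_lt ?_ ?_ <;> gcongr
    _ = ‖p • v + q • w‖ := by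
      congr 1
      apply Complex.ext <;> simp [v, w] <;> ring
    _ ≤ ‖p • v‖ + ‖q • w‖ := norm_add_le _ _
    _ = p * ‖v‖ + q * ‖w‖ := by
      rw [norm_smul_of_nonneg hp.le, norm_smul_of_nonneg hq.le]


/-- Planar form of the first assertion of Lemma 2.6: the flat length
`f(t) = ∑ √(e^{2t}·aᵢ² + e^{-2t}·bᵢ²)` along the Teichmüller geodesic flow
is strictly convex, provided some `uᵢ = (aᵢ, bᵢ)` is nonzero. -/
theorem flat_length_strictly_convex
    (k : ℕ) (u : Fin k → ℝ × ℝ) (hne : ∃ i, u i ≠ 0)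
    (f : ℝ → ℝ)
    (hf : ∀ t, f t = ∑ i,
      Real.sqrt (Real.exp (2 * t) * (u i).1 ^ 2 +
        Real.exp (-(2 * t)) * (u i).2 ^ 2)) :
    StrictConvexOn ℝ Set.univ f := by
  refine ⟨convex_univ, fun x hx y hy hxy p q hp hq hpq ↦ ?_⟩
  have key (i) (hi : u i ≠ 0) :=
    (strictConvexOn_sqrt_exp_mul_sq_add (a := (u i).1) (b := (u i).2)
      (by rwa [Ne, Prod.ext_iff, not_and_or] at hi)).2 hx hy hxy hp hq hpq
  simp only [hf, smul_eq_mul, Finset.mul_sum, ← Finset.sum_add_distrib] at key ⊢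
  obtain ⟨j, hj⟩ := hne
  refine Finset.sum_lt_sum (fun i _ ↦ ?_) ⟨j, Finset.mem_univ j, key j hj⟩
  by_cases hi : u i = 0
  · simp [hi]
  · exact (key i hi).le
end

section
/- Let H, V > 0 be real numbers and let f : ℝ → ℝ be any function satisfying max(e^t·H, e^{-t}·V) ≤ f(t) ≤ e^t·H + e^{-t}·V for all t ∈ ℝ. Let t_b = (1/2)·log(V/H) be the balance time, i.e. the unique real with e^{t_b}·H = e^{-t_b}·V, and let m = inf{f(s) : s ∈ ℝ} (which satisfies m ≥ √(HV) > 0). Then for all t ∈ ℝ, (1/2)·m·cosh(t - t_b) ≤ f(t) ≤ 2·m·cosh(t - t_b). -/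
/-- Abstract form of Lemma 2.6: if `H, V > 0` and
`max(eᵗH, e⁻ᵗV) ≤ f(t) ≤ eᵗH + e⁻ᵗV` for all `t`, then with balance time
`t_b = ½ log(V/H)` and `m = inf f`, for all `t` we have
`½ m cosh(t - t_b) ≤ f(t) ≤ 2 m cosh(t - t_b)`. -/
theorem flat_length_cosh_estimate
    (H V : ℝ) (hH : 0 < H) (hV : 0 < V)
    (f : ℝ → ℝ)
    (hf : ∀ t, max (Real.exp t * H) (Real.exp (-t) * V) ≤ f t ∧
      f t ≤ Real.exp t * H + Real.exp (-t) * V)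
    (tb : ℝ) (htb : tb = (1 / 2) * Real.log (V / H))
    (m : ℝ) (hm : m = sInf (Set.range f)) :
    ∀ t : ℝ, (1 / 2) * m * Real.cosh (t - tb) ≤ f t ∧
      f t ≤ 2 * m * Real.cosh (t - tb) := by
  have hbal : Real.exp tb * H = Real.exp (-tb) * V := by
    have h2 : Real.exp tb * Real.exp tb = V / H := by
      rw [← Real.exp_add, htb, ← Real.exp_log (div_pos hV hH), Real.log_exp]
      ring_nf
    rw [Real.exp_neg]
    have := Real.exp_pos tb
    field_simp at h2 ⊢
    linarith
  set R := Real.exp tb * H with hR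
  have hRpos : 0 < R := by positivity
  have hexpH : ∀ t, Real.exp t * H = R * Real.exp (t - tb) := fun t => by
    rw [hR, mul_right_comm, ← Real.exp_add, add_sub_cancel]
  have hexpV : ∀ t, Real.exp (-t) * V = R * Real.exp (-(t - tb)) := fun t => by
    rw [hbal, mul_right_comm, ← Real.exp_add]
    ring_nf
  have hupper : ∀ t, f t ≤ 2 * R * Real.cosh (t - tb) := fun t => by
    have := (hf t).2
    rw [hexpH, hexpV] at this
    rw [Real.cosh_eq]
    linarith
  have hlower : ∀ t, R * Real.cosh (t - tb) ≤ f t := fun t => by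
    have h := max_le_iff.1 (hf t).1
    rw [hexpH, hexpV] at h
    rw [Real.cosh_eq]
    linarith [h.1, h.2]
  have hlb : ∀ t, R ≤ f t := fun t =>
    (le_mul_of_one_le_right hRpos.le (Real.one_le_cosh _)).trans (hlower t)
  have hRm : R ≤ m := by
    rw [hm]
    exact le_csInf (Set.range_nonempty f) (Set.forall_mem_range.2 hlb)
  have hmR : m ≤ 2 * R := by
    rw [hm]
    refine (csInf_le ⟨R, Set.forall_mem_range.2 hlb⟩ (Set.mem_range_self tb)).trans ?_
    simpa using hupper tb
  intro t
  have hcosh := Real.cosh_pos (t - tb)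
  constructor
  · refine le_trans ?_ (hlower t)
    gcongr
    linarith
  · refine (hupper t).trans ?_
    gcongr
end

section
/- Let H, V > 0 be real numbers and let f : ℝ → ℝ be any function satisfying max(e^t·H, e^{-t}·V) ≤ f(t) ≤ e^t·H + e^{-t}·V for all t ∈ ℝ. Let t_b = (1/2)·log(V/H) be the balance time, i.e. the unique real with e^{t_b}·H = e^{-t_b}·V. If t_m ∈ ℝ satisfies f(t_m) ≤ f(t) for all t ∈ ℝ (i.e. f attains its minimum at t_m), then |t_m - t_b| ≤ arcosh(2). -/
/-- The inverse hyperbolic cosine: `arcosh x = log (x + √(x² - 1))`. -/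
noncomputable def arcosh (x : ℝ) : ℝ := Real.log (x + Real.sqrt (x ^ 2 - 1))

theorem exp_mul_eq_exp_neg_mul_of_balance {H V : ℝ} (hH : 0 < H) (hV : 0 < V) :
    Real.exp ((1 / 2) * Real.log (V / H)) * H =
      Real.exp (-((1 / 2) * Real.log (V / H))) * V := by
  rw [← Real.exp_log hH, ← Real.exp_log hV, ← Real.exp_add, ← Real.exp_add,
    Real.log_div (Real.exp_ne_zero _) (Real.exp_ne_zero _)]
  simp only [Real.log_exp]
  ring_nf

theorem log_two_le_arcosh_two : Real.log 2 ≤ arcosh 2 :=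
  Real.log_le_log two_pos (le_add_of_nonneg_right (Real.sqrt_nonneg _))

theorem sub_le_log_two_of_exp_mul_le {a b c : ℝ} (hc : 0 < c)
    (h : Real.exp a * c ≤ 2 * (Real.exp b * c)) : a - b ≤ Real.log 2 := by
  rw [Real.le_log_iff_exp_le two_pos, Real.exp_sub, div_le_iff₀ (Real.exp_pos b)]
  exact le_of_mul_le_mul_right (by linarith) hc

/-- Abstract form of Lemma 2.6: if `H, V > 0` and
`max(eᵗH, e⁻ᵗV) ≤ f(t) ≤ eᵗH + e⁻ᵗV` for all `t`, with balance time
`t_b = ½ log(V/H)`, then any minimiser `t_m` of `f` satisfies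
`|t_m - t_b| ≤ arcosh 2`. -/
theorem min_near_balance_time
    (H V : ℝ) (hH : 0 < H) (hV : 0 < V)
    (f : ℝ → ℝ)
    (hf : ∀ t, max (Real.exp t * H) (Real.exp (-t) * V) ≤ f t ∧
      f t ≤ Real.exp t * H + Real.exp (-t) * V)
    (tb : ℝ) (htb : tb = (1 / 2) * Real.log (V / H))
    (tm : ℝ) (htm : ∀ t : ℝ, f tm ≤ f t) :
    |tm - tb| ≤ arcosh 2 := by
  have hbal : Real.exp tb * H = Real.exp (-tb) * V := by
    rw [htb]
    exact exp_mul_eq_exp_neg_mul_of_balance hH hV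
  have hmin : max (Real.exp tm * H) (Real.exp (-tm) * V) ≤
      Real.exp tb * H + Real.exp (-tb) * V :=
    (hf tm).1.trans ((htm tb).trans (hf tb).2)
  obtain ⟨hh, hv⟩ := max_le_iff.1 hmin
  have hright : tm - tb ≤ Real.log 2 := sub_le_log_two_of_exp_mul_le hH (by linarith)
  have hleft : -tm - -tb ≤ Real.log 2 := sub_le_log_two_of_exp_mul_le hV (by linarith)
  exact (abs_le.2 ⟨by linarith, hright⟩).trans log_two_le_arcosh_two
end

section
/- Let R > 0 and let P ⊆ ℝ² be any set with B²(R) ⊆ P ⊆ B²(2R), where B²(r) denotes the closed Euclidean ball of radius r about the origin. Let s > 0 and let A : ℝ² → ℝ² be the linear map given by first applying (x,y) ↦ (s·x, y/s) and then rotating about the origin through angle π/4. Let W = sup{|x₁ - x₂| : (x₁,y₁), (x₂,y₂) ∈ A(P)} and Ht = sup{|y₁ - y₂| : (x₁,y₁), (x₂,y₂) ∈ A(P)}. Then (1/2)·W ≤ Ht ≤ 2·W. -/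
/-- The spread of a linear functional of norm `N` on a planar set nested between the closed disks
of radii `R` and `2 * R` lies between `2 * R * N` and `4 * R * N`. -/
theorem spread_linear_mem_Icc {R : ℝ} (hR : 0 < R) {P : Set (ℝ × ℝ)}
    (hPin : {p : ℝ × ℝ | p.1 ^ 2 + p.2 ^ 2 ≤ R ^ 2} ⊆ P)
    (hPout : P ⊆ {p : ℝ × ℝ | p.1 ^ 2 + p.2 ^ 2 ≤ (2 * R) ^ 2})
    {a b N : ℝ} (hN : 0 < N) (hab : a ^ 2 + b ^ 2 = N ^ 2) :
    sSup {d : ℝ | ∃ p ∈ P, ∃ q ∈ P, d = |(a * p.1 + b * p.2) - (a * q.1 + b * q.2)|} ∈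
      Set.Icc (2 * R * N) (4 * R * N) := by
  have hbound : ∀ p ∈ P, |a * p.1 + b * p.2| ≤ 2 * R * N := by
    intro p hp
    have h : p.1 ^ 2 + p.2 ^ 2 ≤ (2 * R) ^ 2 := hPout hp
    refine abs_le_of_sq_le_sq ?_ (by positivity)
    calc (a * p.1 + b * p.2) ^ 2
        ≤ (p.1 ^ 2 + p.2 ^ 2) * (a ^ 2 + b ^ 2) := by
          linarith [sq_nonneg (a * p.2 - b * p.1)]
      _ ≤ (2 * R) ^ 2 * N ^ 2 := by rw [hab]; gcongr
      _ = (2 * R * N) ^ 2 := by ring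
  have hupper : ∀ d ∈ {d : ℝ | ∃ p ∈ P, ∃ q ∈ P,
      d = |(a * p.1 + b * p.2) - (a * q.1 + b * q.2)|}, d ≤ 4 * R * N := by
    rintro d ⟨p, hp, q, hq, rfl⟩
    linarith [abs_sub (a * p.1 + b * p.2) (a * q.1 + b * q.2), hbound p hp, hbound q hq]
  have hunit : (R * a / N) ^ 2 + (R * b / N) ^ 2 = R ^ 2 := by
    field_simp
    linear_combination hab
  have hval : a * (R * a / N) + b * (R * b / N) = R * N := by
    field_simp
    linear_combination hab
  have hmem : 2 * R * N ∈ {d : ℝ | ∃ p ∈ P, ∃ q ∈ P,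
      d = |(a * p.1 + b * p.2) - (a * q.1 + b * q.2)|} := by
    refine ⟨(R * a / N, R * b / N), hPin hunit.le, (-(R * a / N), -(R * b / N)),
      hPin (by simpa only [Set.mem_ofPred_eq, neg_sq] using hunit.le), ?_⟩
    rw [show a * (R * a / N) + b * (R * b / N) - (a * -(R * a / N) + b * -(R * b / N))
      = 2 * R * N by linear_combination 2 * hval, abs_of_pos (by positivity)]
  exact ⟨le_csSup ⟨_, hupper⟩ hmem, csSup_le ⟨_, hmem⟩ hupper⟩


/-- Key planar estimate in the proof of Proposition 7.1: if
`B²(R) ⊆ P ⊆ B²(2R)` and `A` is the diagonal stretch `(x,y) ↦ (s·x, y/s)`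
followed by the rotation through `π/4`, then the width `W` and height `Ht`
of `A(P)` satisfy `½·W ≤ Ht ≤ 2·W`. -/
theorem balance_point_width_height
    (R : ℝ) (hR : 0 < R)
    (P : Set (ℝ × ℝ))
    (hPin : {p : ℝ × ℝ | p.1 ^ 2 + p.2 ^ 2 ≤ R ^ 2} ⊆ P)
    (hPout : P ⊆ {p : ℝ × ℝ | p.1 ^ 2 + p.2 ^ 2 ≤ (2 * R) ^ 2})
    (s : ℝ) (hs : 0 < s)
    (A : ℝ × ℝ → ℝ × ℝ)
    (hA : ∀ p : ℝ × ℝ, A p =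
      (Real.cos (Real.pi / 4) * (s * p.1) - Real.sin (Real.pi / 4) * (p.2 / s),
       Real.sin (Real.pi / 4) * (s * p.1) + Real.cos (Real.pi / 4) * (p.2 / s)))
    (W Ht : ℝ)
    (hW : W = sSup {d : ℝ | ∃ p ∈ A '' P, ∃ q ∈ A '' P, d = |p.1 - q.1|})
    (hHt : Ht = sSup {d : ℝ | ∃ p ∈ A '' P, ∃ q ∈ A '' P, d = |p.2 - q.2|}) :
    (1 / 2) * W ≤ Ht ∧ Ht ≤ 2 * W := by
  set c := Real.cos (Real.pi / 4) with hc
  have hsin : Real.sin (Real.pi / 4) = c := by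
    rw [hc, Real.sin_pi_div_four, Real.cos_pi_div_four]
  have hcpos : 0 < c := by rw [hc, Real.cos_pi_div_four]; positivity
  have hsq : 0 < (c * s) ^ 2 + (c / s) ^ 2 := by positivity
  have hN := Real.sqrt_pos.2 hsq
  have hNsq := Real.sq_sqrt hsq.le
  obtain ⟨hW₁, hW₂⟩ := spread_linear_mem_Icc hR hPin hPout (a := c * s) (b := -(c / s)) hN
    (by rw [hNsq, neg_sq])
  obtain ⟨hH₁, hH₂⟩ := spread_linear_mem_Icc hR hPin hPout (a := c * s) (b := c / s) hN hNsq.symm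
  have hfst : ∀ p, (A p).1 = c * s * p.1 + -(c / s) * p.2 := by
    intro p
    rw [hA, hsin]
    ring
  have hsnd : ∀ p, (A p).2 = c * s * p.1 + c / s * p.2 := by
    intro p
    rw [hA, hsin]
    ring
  simp only [Set.exists_mem_image, hfst] at hW
  simp only [Set.exists_mem_image, hsnd] at hHt
  rw [← hW] at hW₁ hW₂
  rw [← hHt] at hH₁ hH₂
  constructor <;> linarith
end
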